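/- arXiv:2204.03462 — 3 statements merged into one kernel-verified Lean document; each statement's English description precedes it below -/
import Mathlib

section
/- For all integers a ≥ 1 and p ≥ 2 there exist γ > 0, δ > 0 and n₀ such that for all n ≥ n₀ and every integer b with 1 ≤ b ≤ δ·ln n the following holds: if G is a K_p(1,a,b,…,b)-free graph on n vertices (where K_p(1,a,b,…,b) is the complete p-partite graph with one part of size 1, one part of size a, and p−2 parts of size b) with minimum degree at least (1 − 1/(p−1) − γ)n, then there is a partition V(G) = V₁ ⊔ ⋯ ⊔ V_{p−1} such that for every i ∈ {1,…,p−1}, each vertex of V_i has at most a − 1 neighbors in V_i. -/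
open SimpleGraph

/-- `G` contains a copy of `H` (as a subgraph, i.e. there is an injective graph homomorphism). -/
def HasCopy {V W : Type*} (G : SimpleGraph V) (H : SimpleGraph W) : Prop :=
  ∃ f : H →g G, Function.Injective f

/-- The Ramsey number `r(H₁, H₂)`: the smallest `N` such that every graph `G` on `N` vertices
contains `H₁` as a subgraph or its complement contains `H₂` as a subgraph. -/
noncomputable def ramseyNumber {V W : Type*} (H₁ : SimpleGraph V) (H₂ : SimpleGraph W) : ℕ :=
  sInf {N : ℕ | ∀ G : SimpleGraph (Fin N), HasCopy G H₁ ∨ HasCopy Gᶜ H₂}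

/-- The complete multipartite graph `K_p(a₁,…,a_p)` with parts of sizes `a 0, …, a (p-1)`. -/
def KMulti {p : ℕ} (a : Fin p → ℕ) : SimpleGraph (Σ i : Fin p, Fin (a i)) :=
  completeMultipartiteGraph fun i => Fin (a i)

/-- The book graph `B_{k,n}`: the join of `K_k` with an independent set of `n - k` vertices,
realized as the complete multipartite graph with `k` parts of size `1` and one part of
size `n - k`. -/
def Book (k n : ℕ) : SimpleGraph (Σ i : Fin (k + 1), Fin (if (i : ℕ) < k then 1 else n - k)) :=
  completeMultipartiteGraph fun i : Fin (k + 1) => Fin (if (i : ℕ) < k then 1 else n - k)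

/-- The number of neighbors of `v` inside the set `A`. -/
noncomputable def degIn {V : Type*} (G : SimpleGraph V) (v : V) (A : Set V) : ℕ :=
  {u ∈ A | G.Adj v u}.ncard

open scoped Classical in
/-- The vertices of `A` that are not adjacent to `v`. -/
noncomputable def nonNeighbors {V : Type*} (G : SimpleGraph V) (v : V) (A : Finset V) : Finset V :=
  A.filter fun u => ¬ G.Adj v u

open scoped Classical in
/-- The `k`-cliques of `G`, as tuples, whose `i`-th vertex lies in `A i`. -/
noncomputable def cliqueTuples {V : Type*} [Fintype V] (G : SimpleGraph V) {k : ℕ}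
    (A : Fin k → Finset V) : Finset (Fin k → V) :=
  Finset.univ.filter fun f => (∀ i, f i ∈ A i) ∧ Pairwise fun i j => G.Adj (f i) (f j)

theorem sub_mul_le_card_sdiff_biUnion {V ι : Type*} [DecidableEq V] (s : Finset ι) (A : Finset V)
    (B : ι → Finset V) {x : ℕ} (hB : ∀ i ∈ s, (B i).card ≤ x) :
    A.card ≤ (A \ s.biUnion B).card + s.card * x := by
  have h1 := Finset.le_card_sdiff (s.biUnion B) A
  have h2 : (s.biUnion B).card ≤ s.card * x := Finset.card_biUnion_le_card_mul s B x hB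
  omega

open scoped Classical in
/-- Greedy lower bound for the number of transversal cliques. -/
theorem pow_le_card_cliqueTuples {V : Type*} [Fintype V] (G : SimpleGraph V) (x y : ℕ) {k : ℕ}
    (A : Fin k → Finset V) (hA : ∀ i, i * x + y ≤ (A i).card)
    (hx : ∀ i j, i ≠ j → ∀ v ∈ A i, (nonNeighbors G v (A j)).card ≤ x) :
    y ^ k ≤ (cliqueTuples G A).card := by
  induction k with
  | zero =>
    rw [pow_zero]
    refine Finset.card_pos.mpr ⟨fun i => i.elim0, ?_⟩
    simp only [cliqueTuples, Finset.mem_filter, Finset.mem_univ, true_and]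
    exact ⟨fun i => i.elim0, fun i => i.elim0⟩
  | succ k ih =>
    have ih' := ih (fun i => A i.castSucc) (fun i => by simpa using hA i.castSucc)
      (fun i j hij => hx _ _ (by simpa using hij))
    let E : (Fin k → V) → Finset V := fun R =>
      A (Fin.last k) \ Finset.univ.biUnion fun i => nonNeighbors G (R i) (A (Fin.last k))
    have hE : ∀ R ∈ cliqueTuples G (fun i : Fin k => A i.castSucc), y ≤ (E R).card := by
      intro R hR
      simp only [cliqueTuples, Finset.mem_filter, Finset.mem_univ, true_and] at hR
      have h1 := sub_mul_le_card_sdiff_biUnion (x := x) Finset.univ (A (Fin.last k))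
        (fun i => nonNeighbors G (R i) (A (Fin.last k)))
        (fun i _ => hx _ _ (Fin.castSucc_lt_last i).ne _ (hR.1 i))
      have h2 := hA (Fin.last k)
      simp only [Finset.card_univ, Fintype.card_fin, Fin.val_last] at h1 h2
      change y ≤ (A (Fin.last k) \ _).card
      omega
    calc y ^ (k + 1) ≤ (cliqueTuples G (fun i : Fin k => A i.castSucc)).card * y := by
          rw [pow_succ]; gcongr
      _ ≤ ((cliqueTuples G (fun i : Fin k => A i.castSucc)).sigma E).card := by
          rw [Finset.card_sigma, ← smul_eq_mul]
          exact Finset.card_nsmul_le_sum _ _ _ hE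
      _ ≤ (cliqueTuples G A).card := by
          refine Finset.card_le_card_of_injOn
            (fun q => (Fin.snoc q.1 q.2 : Fin (k + 1) → V)) ?_ ?_
          · rintro ⟨R, v⟩ hq
            simp only [Finset.coe_sigma, Set.mem_sigma_iff, Finset.mem_coe, cliqueTuples,
              Finset.mem_filter, Finset.mem_univ, true_and, E, Finset.mem_sdiff,
              Finset.mem_biUnion, nonNeighbors, not_exists, not_and, not_not] at hq ⊢
            obtain ⟨⟨h1, h2⟩, h3, h4⟩ := hq
            have h5 : ∀ i, G.Adj (R i) v := fun i => h4 i h3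
            refine ⟨fun i => ?_, fun i j => ?_⟩
            · refine Fin.lastCases ?_ (fun i => ?_) i
              · simpa using h3
              · simpa using h1 i
            · refine Fin.lastCases ?_ (fun i => ?_) i <;>
                refine Fin.lastCases ?_ (fun j => ?_) j
              · intro h; exact absurd rfl h
              · intro _; simpa using (h5 j).symm
              · intro _; simpa using h5 i
              · intro h; simpa using h2 (by simpa using h)
          · rintro ⟨R, v⟩ _ ⟨R', v'⟩ _ h
            obtain ⟨h1, h2⟩ := Fin.snoc_inj.mp h
            subst h1 h2; rfl

open scoped Classical in
/-- A positive proportion of `k`-cliques forces a complete `k`-partite subgraph with parts of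
logarithmic size, in which some perfect matching consists of the given cliques. -/
theorem exists_blowup_of_card_le (k N : ℕ) : ∃ C, 1 ≤ C ∧
    ∀ {V : Type*} [Fintype V] (G : SimpleGraph V) (t : ℕ), 1 ≤ t → C ^ t ≤ Fintype.card V →
      ∀ S : Finset (Fin k → V), (∀ f ∈ S, Pairwise fun i j => G.Adj (f i) (f j)) →
        Fintype.card V ^ k ≤ N * S.card →
        ∃ F : Fin t → Fin k → V, (∀ a, F a ∈ S) ∧ (∀ i, Function.Injective fun a => F a i) ∧
          ∀ a b i j, i ≠ j → G.Adj (F a i) (F b j) := by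
  induction k generalizing N with
  | zero =>
    refine ⟨1, le_rfl, fun {V} _ G t _ _ S _ h => ?_⟩
    obtain ⟨f, hf⟩ : S.Nonempty := by
      rw [← Finset.card_pos]
      rw [pow_zero] at h
      exact Nat.pos_of_mul_pos_left (lt_of_lt_of_le one_pos h)
    exact ⟨fun _ => f, fun _ => hf, fun i => i.elim0, fun _ _ i => i.elim0⟩
  | succ k ih =>
    obtain ⟨C, hC, H⟩ := ih (2 * N)
    let D := 4 * N
    refine ⟨C ^ D * (D * 2 ^ (D + 1) + 1), Nat.mul_pos (pow_pos hC _) (Nat.succ_pos _),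
      fun {V} _ G t ht hn S hS hcard => ?_⟩
    set n := Fintype.card V with hn_def
    have hn1 : (C ^ D) ^ t ≤ n := le_trans
      (Nat.pow_le_pow_left (Nat.le_mul_of_pos_right _ (Nat.succ_pos _)) t) hn
    have hn2 : (D * 2 ^ (D + 1)) ^ t ≤ n := le_trans
      (Nat.pow_le_pow_left ((Nat.le_succ _).trans
        (Nat.le_mul_of_pos_left _ (pow_pos hC _))) t) hn
    have hn0 : 0 < n := lt_of_lt_of_le (pow_pos (pow_pos hC _) _) hn1
    have hN : 0 < N := by
      rcases Nat.eq_zero_or_pos N with h | h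
      · subst h
        have := pow_pos hn0 (k + 1)
        omega
      · exact h
    let ext : (Fin k → V) → Finset V := fun R =>
      Finset.univ.filter fun v => (Fin.snoc R v : Fin (k + 1) → V) ∈ S
    let L : Finset (Fin k → V) := Finset.univ.filter fun R => n ≤ 2 * N * (ext R).card
    have hSle : S.card ≤ ∑ R, (ext R).card := by
      rw [← Finset.card_sigma]
      refine Finset.card_le_card_of_injOn (fun f => ⟨Fin.init f, f (Fin.last k)⟩) ?_ ?_
      · intro f hf
        simpa [ext, Fin.snoc_init_self] using hf
      · intro f _ g _ h
        simp only [Sigma.mk.injEq, heq_eq_eq] at h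
        rw [← Fin.snoc_init_self f, ← Fin.snoc_init_self g, h.1, h.2]
    have hL : n ^ k ≤ 2 * N * L.card := by
      have h1 : ∀ R, 2 * N * (ext R).card ≤ (if R ∈ L then 2 * N * n else 0) + n := by
        intro R
        split_ifs with h
        · exact le_add_right (Nat.mul_le_mul_left _ (Finset.card_le_univ _))
        · simp only [L, Finset.mem_filter, Finset.mem_univ, true_and, not_le] at h
          omega
      have h2 : 2 * N * ∑ R, (ext R).card ≤ L.card * (2 * N * n) + n ^ k * n := by
        rw [Finset.mul_sum]
        refine (Finset.sum_le_sum fun R _ => h1 R).trans (le_of_eq ?_)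
        rw [Finset.sum_add_distrib, Finset.sum_ite_mem]
        simp [n]
      have h3 : n ^ k * n ≤ (2 * N * L.card) * n := by
        have := Nat.mul_le_mul_left (2 * N) hSle
        rw [pow_succ] at hcard
        nlinarith
      exact Nat.le_of_mul_le_mul_right h3 hn0
    obtain ⟨F, hFL, hFinj, hFadj⟩ := H G (D * t) (Nat.mul_pos (by omega) ht)
      (by rw [pow_mul]; exact hn1) L (by
        intro R hR i j hij
        simp only [L, Finset.mem_filter, Finset.mem_univ, true_and] at hR
        obtain ⟨v, hv⟩ : (ext R).Nonempty := by
          rw [← Finset.card_pos]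
          by_contra h0
          have : (ext R).card = 0 := by omega
          rw [this] at hR
          omega
        simp only [ext, Finset.mem_filter, Finset.mem_univ, true_and] at hv
        have := hS _ hv (show i.castSucc ≠ j.castSucc by simpa using hij)
        simpa using this) hL
    let I : V → Finset (Fin (D * t)) := fun v =>
      Finset.univ.filter fun a => (Fin.snoc (F a) v : Fin (k + 1) → V) ∈ S
    let W : Finset V := Finset.univ.filter fun v => t ≤ (I v).card
    have hdouble : ∑ v, (I v).card = ∑ a, (ext (F a)).card := by
      simp only [I, ext, Finset.card_filter]
      exact Finset.sum_comm
    have hW : n ≤ D * W.card := by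
      have h1 : ∀ v, (I v).card ≤ (if v ∈ W then D * t else 0) + t := by
        intro v
        split_ifs with h
        · exact le_add_right ((Finset.card_le_univ _).trans (by simp))
        · simp only [W, Finset.mem_filter, Finset.mem_univ, true_and, not_le] at h
          omega
      have h2 : ∑ v, (I v).card ≤ W.card * (D * t) + n * t := by
        refine (Finset.sum_le_sum fun v _ => h1 v).trans (le_of_eq ?_)
        rw [Finset.sum_add_distrib, Finset.sum_ite_mem]
        simp [n]
      have h3 : (D * t) * n ≤ 2 * N * ∑ a, (ext (F a)).card := by
        rw [Finset.mul_sum]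
        have : ∀ a, n ≤ 2 * N * (ext (F a)).card := fun a => by
          have := hFL a
          simpa only [L, Finset.mem_filter, Finset.mem_univ, true_and] using this
        calc (D * t) * n = ∑ _a : Fin (D * t), n := by simp
          _ ≤ _ := Finset.sum_le_sum fun a _ => this a
      rw [← hdouble] at h3
      have h4 := h3.trans (Nat.mul_le_mul_left (2 * N) h2)
      have h5 : n * (2 * N * t) ≤ (D * W.card) * (2 * N * t) := by
        simp only [D] at h4 ⊢
        nlinarith
      exact Nat.le_of_mul_le_mul_right h5 (by positivity)
    have hbig : (Finset.univ : Finset (Finset (Fin (D * t)))).card * t ≤ W.card := by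
      have h1 : D * (2 ^ (D * t) * t) ≤ (D * 2 ^ (D + 1)) ^ t := by
        rw [mul_pow, ← pow_mul, Nat.add_mul, pow_add, one_mul]
        exact Nat.mul_le_mul (Nat.le_self_pow (by omega) _)
          (Nat.mul_le_mul_left _ Nat.lt_two_pow_self.le)
      have h2 := (h1.trans hn2).trans hW
      have h3 := Nat.le_of_mul_le_mul_left h2 (by omega)
      simpa using h3
    obtain ⟨J, -, hJ⟩ := Finset.exists_le_card_fiber_of_mul_le_card_of_maps_to
      (f := I) (fun v _ => Finset.mem_univ (I v)) Finset.univ_nonempty hbig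
    obtain ⟨v₀, hv₀⟩ : (W.filter fun v => I v = J).Nonempty := by
      rw [← Finset.card_pos]; omega
    have hJt : t ≤ J.card := by
      simp only [W, Finset.mem_filter, Finset.mem_univ, true_and] at hv₀
      rw [← hv₀.2]; exact hv₀.1
    obtain ⟨e₁⟩ : Nonempty (Fin t ↪ J) :=
      Function.Embedding.nonempty_of_card_le (by simpa using hJt)
    obtain ⟨e₂⟩ : Nonempty (Fin t ↪ (W.filter fun v => I v = J : Finset V)) :=
      Function.Embedding.nonempty_of_card_le (by
        rw [Fintype.card_fin, Fintype.card_coe]; exact hJ)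
    have key : ∀ a b, (Fin.snoc (F (e₁ a)) (e₂ b : V) : Fin (k + 1) → V) ∈ S := by
      intro a b
      have h1 := (Finset.mem_filter.mp (e₂ b).2).2
      have h2 : (e₁ a : Fin (D * t)) ∈ I (e₂ b) := by rw [h1]; exact (e₁ a).2
      exact (Finset.mem_filter.mp h2).2
    have key' : ∀ a b i, G.Adj (F (e₁ a) i) (e₂ b) := by
      intro a b i
      have := hS _ (key a b) (Fin.castSucc_lt_last i).ne
      simpa using this
    refine ⟨fun a => Fin.snoc (F (e₁ a)) (e₂ a : V), fun a => key a a, fun i => ?_,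
      fun a b i j => ?_⟩
    · refine Fin.lastCases ?_ (fun i => ?_) i
      · intro a b h
        simp only [Fin.snoc_last] at h
        exact e₂.injective (Subtype.ext h)
      · intro a b h
        simp only [Fin.snoc_castSucc] at h
        exact e₁.injective (Subtype.ext (hFinj i h))
    · refine Fin.lastCases ?_ (fun i => ?_) i <;> refine Fin.lastCases ?_ (fun j => ?_) j
      · intro h; exact absurd rfl h
      · intro _; simpa using (key' b a j).symm
      · intro _; simpa using key' a b i
      · intro h; simpa using hFadj (e₁ a) (e₁ b) i j (by simpa using h)

open scoped Classical in
/-- Nearly complete large parts `A i` contain logarithmic subsets `T i` that are pairwise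
completely joined. -/
theorem exists_blowup_of_nonNeighbors_le (k N : ℕ) : ∃ C, 1 ≤ C ∧
    ∀ {V : Type*} [Fintype V] (G : SimpleGraph V) (t x y : ℕ), 1 ≤ t → C ^ t ≤ Fintype.card V →
      Fintype.card V ≤ N * y → ∀ A : Fin k → Finset V, (∀ i, i * x + y ≤ (A i).card) →
      (∀ i j, i ≠ j → ∀ v ∈ A i, (nonNeighbors G v (A j)).card ≤ x) →
      ∃ T : Fin k → Finset V, (∀ i, T i ⊆ A i) ∧ (∀ i, (T i).card = t) ∧
        ∀ i j, i ≠ j → ∀ u ∈ T i, ∀ w ∈ T j, G.Adj u w := by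
  obtain ⟨C, hC, H⟩ := exists_blowup_of_card_le k (N ^ k)
  refine ⟨C, hC, fun {V} _ G t x y ht hn hy A hA hx => ?_⟩
  obtain ⟨F, h1, h2, h3⟩ := H G t ht hn (cliqueTuples G A)
    (fun f hf => (Finset.mem_filter.mp hf).2.2) (by
      calc Fintype.card V ^ k ≤ (N * y) ^ k := Nat.pow_le_pow_left hy k
        _ = N ^ k * y ^ k := mul_pow _ _ _
        _ ≤ _ := Nat.mul_le_mul_left _ (pow_le_card_cliqueTuples G x y A hA hx))
  refine ⟨fun i => Finset.univ.image fun a => F a i, fun i => ?_, fun i => ?_, ?_⟩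
  · intro v hv
    obtain ⟨a, -, rfl⟩ := Finset.mem_image.mp hv
    exact (Finset.mem_filter.mp (h1 a)).2.1 i
  · rw [Finset.card_image_of_injective _ (h2 i)]; simp
  · intro i j hij u hu w hw
    obtain ⟨a, -, rfl⟩ := Finset.mem_image.mp hu
    obtain ⟨b, -, rfl⟩ := Finset.mem_image.mp hw
    exact h3 a b i j hij

theorem hasCopy_KMulti_of_parts {V : Type*} {G : SimpleGraph V} {p : ℕ} (c : Fin p → ℕ)
    (B : Fin p → Finset V) (hB : ∀ i, c i ≤ (B i).card)
    (hadj : ∀ i j, i ≠ j → ∀ u ∈ B i, ∀ w ∈ B j, G.Adj u w) : HasCopy G (KMulti c) := by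
  have he : ∀ i, Nonempty (Fin (c i) ↪ B i) := fun i =>
    Function.Embedding.nonempty_of_card_le (by simpa using hB i)
  let e : ∀ i, Fin (c i) ↪ B i := fun i => (he i).some
  refine ⟨⟨fun z => (e z.1 z.2 : V), ?_⟩, ?_⟩
  · rintro ⟨i, x⟩ ⟨j, y⟩ h
    have hij : i ≠ j := by simpa [KMulti] using h
    exact hadj i j hij _ (e i x).2 _ (e j y).2
  · rintro ⟨i, x⟩ ⟨j, y⟩ h
    have h' : (e i x : V) = (e j y : V) := h
    by_cases hij : i = j
    · subst hij
      rw [(e i).injective (Subtype.ext h')]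
    · exact absurd h' (hadj i j hij _ (e i x).2 _ (e j y).2).ne

/-- The graph `K_{s+2}(1,a,b,…,b)`, built from a vertex, `a` of its neighbors, and `s` further
parts of size `b`. -/
theorem hasCopy_of_star {V : Type*} {G : SimpleGraph V} {a b s : ℕ} (v : V) (A : Finset V)
    (T : Fin s → Finset V) (hA : a ≤ A.card) (hT : ∀ i, b ≤ (T i).card)
    (hvA : ∀ u ∈ A, G.Adj v u) (hvT : ∀ i, ∀ u ∈ T i, G.Adj v u)
    (hAT : ∀ i, ∀ w ∈ A, ∀ u ∈ T i, G.Adj w u)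
    (hTT : ∀ i j, i ≠ j → ∀ u ∈ T i, ∀ w ∈ T j, G.Adj u w) :
    HasCopy G (KMulti (fun i : Fin (s + 2) =>
      if (i : ℕ) = 0 then 1 else if (i : ℕ) = 1 then a else b)) := by
  refine hasCopy_KMulti_of_parts _ (Fin.cons {v} (Fin.cons A T)) (fun i => ?_) (fun i j => ?_)
  · refine Fin.cases (by simp) (fun i => ?_) i
    refine Fin.cases (by simpa using hA) (fun i => ?_) i
    simpa using hT i
  · refine Fin.cases ?_ (fun i => ?_) i <;> refine Fin.cases ?_ (fun j => ?_) j
    · intro h; exact absurd rfl h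
    · intro _ u hu w hw
      simp only [Fin.cons_zero, Finset.mem_singleton] at hu
      subst hu
      simp only [Fin.cons_succ] at hw
      revert hw
      refine Fin.cases ?_ (fun j => ?_) j
      · exact hvA w
      · exact hvT j w
    · intro _ u hu w hw
      simp only [Fin.cons_zero, Finset.mem_singleton] at hw
      subst hw
      simp only [Fin.cons_succ] at hu
      revert hu
      refine Fin.cases ?_ (fun i => ?_) i
      · exact fun h => (hvA u h).symm
      · exact fun h => (hvT i u h).symm
    · refine Fin.cases ?_ (fun i => ?_) i <;> refine Fin.cases ?_ (fun j => ?_) j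
      · intro h; exact absurd rfl h
      · intro _ u hu w hw
        exact hAT j u hu w hw
      · intro _ u hu w hw
        exact (hAT i w hw u hu).symm
      · intro h u hu w hw
        exact hTT i j (by simpa using h) u hu w hw

theorem hasCopy_of_cone {V : Type*} {G : SimpleGraph V} {a b s : ℕ} (hab : a ≤ b) (v : V)
    (T : Fin (s + 1) → Finset V) (hT : ∀ i, b ≤ (T i).card) (hvT : ∀ i, ∀ u ∈ T i, G.Adj v u)
    (hTT : ∀ i j, i ≠ j → ∀ u ∈ T i, ∀ w ∈ T j, G.Adj u w) :
    HasCopy G (KMulti (fun i : Fin (s + 2) =>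
      if (i : ℕ) = 0 then 1 else if (i : ℕ) = 1 then a else b)) :=
  hasCopy_of_star v (T 0) (fun i => T i.succ) (hab.trans (hT 0)) (fun i => hT _) (hvT 0)
    (fun i => hvT _) (fun i => hTT _ _ (Fin.succ_ne_zero i).symm)
    (fun i j hij => hTT _ _ (by simpa using hij))

open scoped Classical in
theorem card_filter_adj_add_card_nonNeighbors {V : Type*} (G : SimpleGraph V) (v : V)
    (A : Finset V) : (A.filter (G.Adj v)).card + (nonNeighbors G v A).card = A.card :=
  Finset.card_filter_add_card_filter_not (s := A) (G.Adj v)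

open scoped Classical in
/-- The vertices of `X` adjacent to every vertex of `S`. -/
noncomputable def commonIn {V : Type*} (G : SimpleGraph V) (S X : Finset V) : Finset V :=
  X \ S.biUnion fun w => nonNeighbors G w X

theorem mem_commonIn {V : Type*} {G : SimpleGraph V} {S X : Finset V} {u : V} :
    u ∈ commonIn G S X ↔ u ∈ X ∧ ∀ w ∈ S, G.Adj w u := by
  simp only [commonIn, Finset.mem_sdiff, Finset.mem_biUnion, nonNeighbors, Finset.mem_filter,
    not_exists, not_and, not_not]
  exact ⟨fun h => ⟨h.1, fun w hw => h.2 w hw h.1⟩, fun h => ⟨h.1, fun w hw _ => h.2 w hw⟩⟩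

open scoped Classical in
theorem card_le_card_commonIn {V : Type*} (G : SimpleGraph V) (S X : Finset V) {x : ℕ}
    (h : ∀ w ∈ S, (nonNeighbors G w X).card ≤ x) :
    X.card ≤ (commonIn G S X).card + S.card * x := by
  exact sub_mul_le_card_sdiff_biUnion S X (fun w => nonNeighbors G w X) h

theorem card_nonNeighbors_add_le {V : Type*} [Fintype V] (G : SimpleGraph V) (v : V)
    {A B : Finset V} (h : Disjoint A B) :
    (nonNeighbors G v A).card + (nonNeighbors G v B).card ≤
      (nonNeighbors G v Finset.univ).card := by
  classical
  have hd : Disjoint (nonNeighbors G v A) (nonNeighbors G v B) :=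
    Finset.disjoint_filter_filter h
  rw [← Finset.card_union_of_disjoint hd]
  refine Finset.card_le_card (Finset.union_subset ?_ ?_) <;>
    exact Finset.filter_subset_filter _ (Finset.subset_univ _)

theorem card_nonNeighbors_mono {V : Type*} (G : SimpleGraph V) (v : V) {A B : Finset V}
    (h : A ⊆ B) : (nonNeighbors G v A).card ≤ (nonNeighbors G v B).card := by
  classical
  exact Finset.card_le_card (Finset.filter_subset_filter _ h)

open scoped Classical in
/-- A large complete multipartite subgraph induces classes of small internal degree that cover
all but few vertices. -/
theorem exists_classes_of_blowup {V : Type*} [Fintype V] {G : SimpleGraph V} {a b s t q D : ℕ}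
    (hab : a ≤ b)
    (hfree : ¬ HasCopy G (KMulti (fun i : Fin (s + 2) =>
      if (i : ℕ) = 0 then 1 else if (i : ℕ) = 1 then a else b)))
    (hD : ∀ v, (nonNeighbors G v Finset.univ).card ≤ D) (hq : (a + 1) * q + b ≤ t)
    (T : Fin (s + 1) → Finset V) (hTcard : ∀ i, (T i).card = t)
    (hTT : ∀ i j, i ≠ j → ∀ u ∈ T i, ∀ w ∈ T j, G.Adj u w) :
    ∃ U : Fin (s + 1) → Finset V, (∀ i j, i ≠ j → Disjoint (U i) (U j)) ∧
      (∀ i, ∀ v ∈ U i, ((U i).filter (G.Adj v)).card < a) ∧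
      Fintype.card V * t + q * (Finset.univ \ Finset.univ.biUnion U).card ≤
        (s + 1) * t * D + Fintype.card V * b := by
  have hι : ∀ v, ∃ i, t ≤ (nonNeighbors G v (T i)).card + b := by
    intro v
    by_contra! h
    refine hfree (hasCopy_of_cone hab v (fun i => (T i).filter (G.Adj v)) (fun i => ?_)
      (fun i u hu => (Finset.mem_filter.mp hu).2) (fun i j hij u hu w hw =>
        hTT i j hij u (Finset.mem_filter.mp hu).1 w (Finset.mem_filter.mp hw).1))
    have h1 := card_filter_adj_add_card_nonNeighbors G v (T i)
    have h2 := h i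
    have h3 := hTcard i
    change b ≤ ((T i).filter (G.Adj v)).card
    omega
  choose ι hι using hι
  let good : V → Prop := fun v => ∀ j, j ≠ ι v → (nonNeighbors G v (T j)).card ≤ q
  let U : Fin (s + 1) → Finset V := fun i => Finset.univ.filter fun v => good v ∧ ι v = i
  have hU : ∀ i v, v ∈ U i ↔ good v ∧ ι v = i := by simp [U]
  refine ⟨U, fun i j hij => ?_, fun i v hv => ?_, ?_⟩
  · rw [Finset.disjoint_left]
    intro v hv hv'
    exact hij (((hU i v).mp hv).2.symm.trans ((hU j v).mp hv').2)
  · by_contra! h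
    obtain ⟨A, hAsub, hAcard⟩ := Finset.exists_subset_card_eq h
    have hS : ∀ w ∈ insert v A, w ∈ U i := by
      intro w hw
      rcases Finset.mem_insert.mp hw with rfl | hw
      · exact hv
      · exact (Finset.mem_filter.mp (hAsub hw)).1
    refine hfree (hasCopy_of_star v A (fun j => commonIn G (insert v A) (T (i.succAbove j)))
      hAcard.ge (fun j => ?_) (fun u hu => (Finset.mem_filter.mp (hAsub hu)).2)
      (fun j u hu => (mem_commonIn.mp hu).2 v (Finset.mem_insert_self _ _))
      (fun j w hw u hu => (mem_commonIn.mp hu).2 w (Finset.mem_insert_of_mem hw))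
      (fun j k hjk u hu w hw => hTT _ _ (by simpa using hjk) u (mem_commonIn.mp hu).1 w
        (mem_commonIn.mp hw).1))
    have h1 := card_le_card_commonIn G (insert v A) (T (i.succAbove j)) (x := q) (by
      intro w hw
      obtain ⟨h2, h3⟩ := (hU i w).mp (hS w hw)
      exact h2 _ (by rw [h3]; exact Fin.succAbove_ne i j))
    have h2 : (insert v A).card * q ≤ (a + 1) * q :=
      Nat.mul_le_mul_right _ (by rw [← hAcard]; exact Finset.card_insert_le _ _)
    rw [hTcard] at h1
    omega
  · have hpt : ∀ v, t + (if v ∈ Finset.univ \ Finset.univ.biUnion U then q else 0) ≤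
        ∑ j, (nonNeighbors G v (T j)).card + b := by
      intro v
      split_ifs with h
      · have hbad : ¬ good v := by
          intro hg
          refine (Finset.mem_sdiff.mp h).2 (Finset.mem_biUnion.mpr ⟨ι v, Finset.mem_univ _, ?_⟩)
          exact (hU _ _).mpr ⟨hg, rfl⟩
        simp only [good, not_forall, not_le] at hbad
        obtain ⟨j, hj, hjq⟩ := hbad
        have h1 : ∑ k ∈ {ι v, j}, (nonNeighbors G v (T k)).card ≤
            ∑ k, (nonNeighbors G v (T k)).card :=
          Finset.sum_le_sum_of_subset (Finset.subset_univ _)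
        rw [Finset.sum_pair hj.symm] at h1
        have := hι v
        omega
      · have h1 := Finset.single_le_sum (f := fun k => (nonNeighbors G v (T k)).card)
          (fun _ _ => Nat.zero_le _) (Finset.mem_univ (ι v))
        have := hι v
        omega
    have hdouble : ∑ v, ∑ j, (nonNeighbors G v (T j)).card =
        ∑ j, ∑ u ∈ T j, (nonNeighbors G u Finset.univ).card := by
      rw [Finset.sum_comm]
      refine Finset.sum_congr rfl fun j _ => ?_
      simp only [nonNeighbors, Finset.card_filter]
      rw [Finset.sum_comm]
      simp only [G.adj_comm]
    have hle : ∑ j, ∑ u ∈ T j, (nonNeighbors G u Finset.univ).card ≤ (s + 1) * t * D := by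
      calc ∑ j, ∑ u ∈ T j, (nonNeighbors G u Finset.univ).card
          ≤ ∑ j, ∑ u ∈ T j, D := Finset.sum_le_sum fun j _ => Finset.sum_le_sum fun u _ => hD u
        _ = (s + 1) * t * D := by simp [hTcard, mul_assoc]
    have hsum := Finset.sum_le_sum fun v (_ : v ∈ Finset.univ) => hpt v
    rw [Finset.sum_add_distrib, Finset.sum_add_distrib, Finset.sum_ite_mem, hdouble] at hsum
    simp only [Finset.sum_const, Finset.univ_inter, smul_eq_mul, Finset.card_univ] at hsum
    rw [mul_comm q]
    omega

open scoped Classical in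
/-- Classes of small internal degree that cover all but few vertices can be rearranged into a
partition of all vertices, when nearly complete large sets contain blow-ups. -/
theorem exists_coloring_of_classes {V : Type*} [Fintype V] {G : SimpleGraph V}
    {a b s h D x κ : ℕ} (hab : a ≤ b) (hah : a ≤ h)
    (hfree : ¬ HasCopy G (KMulti (fun i : Fin (s + 2) =>
      if (i : ℕ) = 0 then 1 else if (i : ℕ) = 1 then a else b)))
    (hD : ∀ v, (nonNeighbors G v Finset.univ).card ≤ D)
    (hDn : (s + 1) * D ≤ Fintype.card V + (s + 1) * h)
    (hx : x = (2 * (s + 1) + 2) * h) (hκ : κ = (s + 1) * x + h)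
    (hn : (s + 1) * (2 * (s + 1) * h + ((a + 1) * ((2 * (s + 1) + 1) * h + κ) + κ)) ≤
      Fintype.card V)
    (hblow : ∀ k, k ≤ s + 1 → ∀ A : Fin k → Finset V, (∀ i, i * x + h ≤ (A i).card) →
      (∀ i j, i ≠ j → ∀ v ∈ A i, (nonNeighbors G v (A j)).card ≤ x) →
      ∃ T : Fin k → Finset V, (∀ i, T i ⊆ A i) ∧ (∀ i, (T i).card = b) ∧
        ∀ i j, i ≠ j → ∀ u ∈ T i, ∀ w ∈ T j, G.Adj u w)
    (U : Fin (s + 1) → Finset V) (hUdisj : ∀ i j, i ≠ j → Disjoint (U i) (U j))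
    (hUdeg : ∀ i, ∀ v ∈ U i, ((U i).filter (G.Adj v)).card < a)
    (hUcover : (Finset.univ \ Finset.univ.biUnion U).card ≤ h) :
    ∃ φ : V → Fin (s + 1), ∀ v,
      (Finset.univ.filter fun u => φ u = φ v ∧ G.Adj v u).card < a := by
  have hUle : ∀ i, (U i).card ≤ D + h := by
    intro i
    rcases (U i).eq_empty_or_nonempty with h0 | ⟨v, hv⟩
    · simp [h0]
    · have h1 := card_filter_adj_add_card_nonNeighbors G v (U i)
      have h2 := hUdeg i v hv
      have h3 := (card_nonNeighbors_mono G v (Finset.subset_univ (U i))).trans (hD v)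
      omega
  have hUge : ∀ i, Fintype.card V ≤ (s + 1) * ((U i).card + 2 * (s + 1) * h) := by
    intro i
    have h1 : Fintype.card V ≤ h + (Finset.univ.biUnion U).card := by
      have := Finset.card_sdiff_add_card_eq_card (Finset.subset_univ (Finset.univ.biUnion U))
      rw [Finset.card_univ] at this
      omega
    have h2 : (Finset.univ.biUnion U).card ≤ (U i).card + s * (D + h) := by
      refine Finset.card_biUnion_le.trans ?_
      rw [Fin.sum_univ_succAbove _ i]
      refine Nat.add_le_add_left ?_ _
      refine (Finset.sum_le_sum fun j _ => hUle (i.succAbove j)).trans ?_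
      simp
    have h3 := h1.trans (Nat.add_le_add_left h2 _)
    nlinarith [Nat.mul_le_mul_left (s + 1) h3, Nat.mul_le_mul_left s hDn]
  have hDU : ∀ i, D ≤ (U i).card + (2 * (s + 1) + 1) * h := by
    intro i
    have h1 : (s + 1) * D ≤ (s + 1) * ((U i).card + (2 * (s + 1) + 1) * h) := by
      nlinarith [hUge i]
    exact Nat.le_of_mul_le_mul_left h1 (Nat.succ_pos s)
  have hUbig : ∀ i, (a + 1) * ((2 * (s + 1) + 1) * h + κ) + κ ≤ (U i).card := by
    intro i
    have := Nat.le_of_mul_le_mul_left (hn.trans (hUge i)) (Nat.succ_pos s)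
    omega
  have hUx : ∀ i j, i ≠ j → ∀ v ∈ U i, (nonNeighbors G v (U j)).card ≤ x := by
    intro i j hij v hv
    have h1 := card_filter_adj_add_card_nonNeighbors G v (U i)
    have h2 := hUdeg i v hv
    have h3 := (card_nonNeighbors_add_le G v (hUdisj i j hij)).trans (hD v)
    have h4 := hDU i
    rw [add_mul] at h4
    rw [hx, add_mul]
    omega
  have hidx : ∀ i : Fin (s + 1), i * x + h ≤ κ := fun i => by
    rw [hκ]; exact Nat.add_le_add_right (Nat.mul_le_mul_right _ i.2.le) _
  have hφ : ∀ v, ∃ i, ((U i).filter (G.Adj v)).card < κ := by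
    intro v
    by_contra! hv
    obtain ⟨T, hTsub, hTcard, hTT⟩ := hblow (s + 1) le_rfl (fun i => (U i).filter (G.Adj v))
      (fun i => (hidx i).trans (hv i))
      (fun i j hij w hw => (card_nonNeighbors_mono G w (Finset.filter_subset _ _)).trans
        (hUx i j hij w (Finset.mem_filter.mp hw).1))
    exact hfree (hasCopy_of_cone hab v T (fun i => (hTcard i).ge)
      (fun i u hu => (Finset.mem_filter.mp (hTsub i hu)).2) hTT)
  choose φ hφ using hφ
  have hφx : ∀ v j, j ≠ φ v →
      (nonNeighbors G v (U j)).card ≤ (2 * (s + 1) + 1) * h + κ := by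
    intro v j hj
    have h1 := card_filter_adj_add_card_nonNeighbors G v (U (φ v))
    have h2 := hφ v
    have h3 := (card_nonNeighbors_add_le G v (hUdisj _ _ hj)).trans (hD v)
    have h4 := hDU (φ v)
    omega
  refine ⟨φ, fun v => ?_⟩
  by_contra! hv
  obtain ⟨A, hAsub, hAcard⟩ := Finset.exists_subset_card_eq hv
  have hAprop : ∀ u ∈ A, φ u = φ v ∧ G.Adj v u := fun u hu => by
    simpa using hAsub hu
  have hS : ∀ w ∈ insert v A, φ w = φ v := by
    intro w hw
    rcases Finset.mem_insert.mp hw with rfl | hw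
    · rfl
    · exact (hAprop w hw).1
  obtain ⟨T, hTsub, hTcard, hTT⟩ := hblow s (Nat.le_succ s)
    (fun j => commonIn G (insert v A) (U ((φ v).succAbove j)))
    (fun j => by
      have h1 := card_le_card_commonIn G (insert v A) (U ((φ v).succAbove j))
        (x := (2 * (s + 1) + 1) * h + κ) (fun w hw => hφx w _ (by
          rw [hS w hw]; exact Fin.succAbove_ne _ _))
      have h2 : (insert v A).card * ((2 * (s + 1) + 1) * h + κ) ≤
          (a + 1) * ((2 * (s + 1) + 1) * h + κ) :=
        Nat.mul_le_mul_right _ (by rw [← hAcard]; exact Finset.card_insert_le _ _)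
      have h3 := hUbig ((φ v).succAbove j)
      have h4 := hidx j.castSucc
      simp only [Fin.val_castSucc] at h4
      omega)
    (fun i j hij w hw =>
      (card_nonNeighbors_mono G w (Finset.sdiff_subset)).trans
        (hUx _ _ (by simpa using hij) w (mem_commonIn.mp hw).1))
  exact hfree (hasCopy_of_star v A T hAcard.ge (fun j => (hTcard j).ge)
    (fun u hu => (hAprop u hu).2)
    (fun j u hu => (mem_commonIn.mp (hTsub j hu)).2 v (Finset.mem_insert_self _ _))
    (fun j w hw u hu => (mem_commonIn.mp (hTsub j hu)).2 w (Finset.mem_insert_of_mem hw)) hTT)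

theorem hasCopy_KMulti_mono {V : Type*} {G : SimpleGraph V} {p : ℕ} {c c' : Fin p → ℕ}
    (h : ∀ i, c i ≤ c' i) : HasCopy G (KMulti c') → HasCopy G (KMulti c) := by
  rintro ⟨f, hf⟩
  refine ⟨⟨fun z => f ⟨z.1, Fin.castLE (h z.1) z.2⟩, ?_⟩, ?_⟩
  · rintro ⟨i, x⟩ ⟨j, y⟩ hxy
    apply f.map_adj
    simpa [KMulti] using hxy
  · rintro ⟨i, x⟩ ⟨j, y⟩ hxy
    have h1 := hf hxy
    simp only [Sigma.mk.injEq] at h1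
    obtain ⟨rfl, h2⟩ := h1
    rw [Fin.castLE_injective _ (eq_of_heq h2)]

set_option maxHeartbeats 1000000 in
open scoped Classical in
/-- The stability theorem with integer parameters: the minimum degree condition is expressed by
the numbers of non-neighbors, and the logarithmic condition by `C ^ b ≤ |V|`. -/
theorem exists_coloring_of_nonNeighbors_le (a s : ℕ) : ∃ L C, 1 ≤ L ∧ 1 ≤ C ∧
    ∀ {V : Type*} [Fintype V] (G : SimpleGraph V) (b : ℕ), 1 ≤ b → a ≤ b →
      C ^ b ≤ Fintype.card V →
      ¬ HasCopy G (KMulti (fun i : Fin (s + 2) =>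
        if (i : ℕ) = 0 then 1 else if (i : ℕ) = 1 then a else b)) →
      (∀ v, L * (s + 1) * (nonNeighbors G v Finset.univ).card ≤ (L + 1) * Fintype.card V) →
      ∃ φ : V → Fin (s + 1), ∀ v,
        (Finset.univ.filter fun u => φ u = φ v ∧ G.Adj v u).card < a := by
  obtain ⟨κ₀, hκ₀⟩ : ∃ κ₀, κ₀ = (s + 1) * (2 * (s + 1) + 2) + 1 := ⟨_, rfl⟩
  obtain ⟨K, hK⟩ : ∃ K, K = (s + 1) * (2 * (s + 1) + ((a + 1) * ((2 * (s + 1) + 1) + κ₀) + κ₀)) :=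
    ⟨_, rfl⟩
  have hK2 : 2 * (s + 1) ≤ K := by
    rw [hK]
    nlinarith [Nat.zero_le ((a + 1) * ((2 * (s + 1) + 1) + κ₀) + κ₀)]
  obtain ⟨M, hM⟩ : ∃ M, M = (a + 1) * (4 * K) + 1 := ⟨_, rfl⟩
  obtain ⟨L, hL⟩ : ∃ L, L = 2 * (s + 1) * M * K := ⟨_, rfl⟩
  have hM1 : 1 ≤ M := by omega
  have hK1 : 1 ≤ K := by omega
  have hL2s : 2 * (s + 1) ≤ L := by
    rw [hL, mul_assoc]; exact Nat.le_mul_of_pos_right _ (Nat.mul_pos hM1 hK1)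
  have hLM : M ≤ L := by
    rw [hL, mul_comm (2 * (s + 1)), mul_assoc]
    exact Nat.le_mul_of_pos_right _ (Nat.mul_pos (by omega) hK1)
  have hLK : 2 * K ≤ L := by
    rw [hL]
    exact Nat.mul_le_mul_right _ (by nlinarith)
  choose c hc1 hc using fun k => exists_blowup_of_nonNeighbors_le k (2 * K)
  obtain ⟨P, hP⟩ : ∃ P, P = ∏ k ∈ Finset.range (s + 2), c k := ⟨_, rfl⟩
  have hcP : ∀ k, k ≤ s + 1 → c k ≤ P := fun k hk => by
    rw [hP]
    exact Finset.single_le_prod' (fun i _ => hc1 i) (Finset.mem_range.mpr (by omega))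
  have hP1 : 1 ≤ P := (hc1 0).trans (hcP 0 (Nat.zero_le _))
  refine ⟨L, P ^ M * (K * (a + 1)), by omega,
    Nat.mul_pos (pow_pos hP1 _) (Nat.mul_pos hK1 (Nat.succ_pos a)),
    fun {V} _ G b hb hab hn hfree hdeg => ?_⟩
  obtain ⟨n, hn_def⟩ : ∃ n, n = Fintype.card V := ⟨_, rfl⟩
  rw [← hn_def] at hn hdeg
  have hnP : P ^ (M * b) ≤ n := by
    rw [pow_mul]
    exact (Nat.pow_le_pow_left
      (Nat.le_mul_of_pos_right _ (Nat.mul_pos hK1 (Nat.succ_pos a))) b).trans hn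
  have hnK : K * (a + 1) ≤ n :=
    ((Nat.le_mul_of_pos_left _ (pow_pos hP1 M)).trans (Nat.le_self_pow (by omega) _)).trans hn
  have hn0 : 0 < n := lt_of_lt_of_le (Nat.mul_pos hK1 (Nat.succ_pos a)) hnK
  obtain ⟨h, hh⟩ : ∃ h, h = n / K := ⟨_, rfl⟩
  have hah : a + 1 ≤ h := by
    rw [hh, Nat.le_div_iff_mul_le hK1, mul_comm]; exact hnK
  have hKh : K * h ≤ n := by rw [hh]; exact Nat.mul_div_le n K
  have hnh : n ≤ 2 * K * h := by
    have h1 := Nat.lt_mul_div_succ n hK1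
    rw [← hh] at h1
    nlinarith
  have hLr : 0 < L * (s + 1) := Nat.mul_pos (by omega) (Nat.succ_pos s)
  obtain ⟨D, hD⟩ : ∃ D, D = (L + 1) * n / (L * (s + 1)) := ⟨_, rfl⟩
  have hdegD : ∀ v, (nonNeighbors G v Finset.univ).card ≤ D := fun v => by
    rw [hD, Nat.le_div_iff_mul_le hLr, mul_comm]
    exact hdeg v
  have hDn : L * (s + 1) * D ≤ (L + 1) * n := by rw [hD]; exact Nat.mul_div_le _ _
  have hDn' : (s + 1) * D ≤ n + (s + 1) * h := by
    have h1 : L * ((s + 1) * D) ≤ L * (n + (s + 1) * h) := by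
      have h2 : n ≤ L * h := hnh.trans (Nat.mul_le_mul_right _ hLK)
      have h3 : L * h ≤ L * ((s + 1) * h) :=
        Nat.mul_le_mul_left _ (Nat.le_mul_of_pos_left _ (Nat.succ_pos s))
      nlinarith
    exact Nat.le_of_mul_le_mul_left h1 (by omega)
  have hsD : s * D + h ≤ n := by
    have h1 : (L * (s + 1)) * (s * D + h) ≤ (L * (s + 1)) * n := by
      have h2 : 2 * (s + 1) * h ≤ n := (Nat.mul_le_mul_right _ hK2).trans hKh
      have h3 := Nat.mul_le_mul_left s hDn
      have h4 := Nat.mul_le_mul_left L h2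
      have h5 := Nat.mul_le_mul_right n hL2s
      nlinarith
    exact Nat.le_of_mul_le_mul_left h1 hLr
  obtain ⟨T, -, hTcard, hTT⟩ := hc (s + 1) G (M * b) D h (Nat.mul_pos hM1 hb)
    (by rw [← hn_def]; exact (Nat.pow_le_pow_left (hcP _ le_rfl) _).trans hnP)
    (by rw [← hn_def]; exact hnh) (fun _ => Finset.univ)
    (fun i => by
      rw [Finset.card_univ, ← hn_def]
      exact (Nat.add_le_add_right (Nat.mul_le_mul_right _ (Nat.le_of_lt_succ i.2)) _).trans hsD)
    (fun _ _ _ v _ => hdegD v)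
  obtain ⟨U, hUdisj, hUdeg, hUcover⟩ := exists_classes_of_blowup (q := 4 * K * b) hab hfree hdegD
    (by rw [hM]; nlinarith) T hTcard hTT
  rw [← hn_def] at hUcover
  refine exists_coloring_of_classes (h := h) hab (by omega) hfree hdegD
    (by rw [← hn_def]; exact hDn') rfl rfl (le_of_eq_of_le ?_ (hKh.trans hn_def.le)) ?_ U hUdisj
    hUdeg ?_
  · rw [hK, hκ₀]; ring
  · intro k hk A hA hx
    exact hc k G b _ h hb
      (by
        rw [← hn_def]
        exact ((Nat.pow_le_pow_left (hcP _ hk) _).trans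
          (Nat.pow_le_pow_right hP1 (Nat.le_mul_of_pos_left _ hM1))).trans hnP)
      (by rw [← hn_def]; exact hnh) A hA hx
  · obtain ⟨w, hw⟩ : ∃ w, w = (Finset.univ \ Finset.univ.biUnion U).card := ⟨_, rfl⟩
    rw [← hw] at hUcover ⊢
    have h1 : (L * b) * (4 * K * w) ≤ (L * b) * (2 * n) := by
      have h2 := Nat.mul_le_mul_left L hUcover
      have h3 := Nat.mul_le_mul_left (M * b) hDn
      have h4 := Nat.mul_le_mul_right (b * n) hLM
      nlinarith
    have h2 := Nat.le_of_mul_le_mul_left h1 (Nat.mul_pos (by omega) hb)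
    have h3 : 4 * K * w ≤ 4 * K * h := by nlinarith
    exact Nat.le_of_mul_le_mul_left h3 (by omega)

/-- Lemma 5.3: for `a ≥ 1`, `p ≥ 2` there are `γ, δ > 0` and `n₀` such that for all
`n ≥ n₀` and `1 ≤ b ≤ δ ln n`, every `K_p(1,a,b,…,b)`-free graph on `n` vertices with
minimum degree at least `(1 - 1/(p-1) - γ)n` admits a partition `V(G) = V₁ ⊔ ⋯ ⊔ V_{p-1}`
where each vertex of `V_i` has at most `a - 1` neighbors in `V_i`. -/
theorem aes_stability_log (a p : ℕ) (ha : 1 ≤ a) (hp : 2 ≤ p) :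
    ∃ γ : ℝ, 0 < γ ∧ ∃ δ : ℝ, 0 < δ ∧ ∃ n₀ : ℕ, ∀ n : ℕ, n₀ ≤ n →
      ∀ b : ℕ, 1 ≤ b → (b : ℝ) ≤ δ * Real.log n →
      ∀ G : SimpleGraph (Fin n),
        ¬ HasCopy G (KMulti (fun i : Fin p =>
            if (i : ℕ) = 0 then 1 else if (i : ℕ) = 1 then a else b)) →
        (∀ v, (1 - 1 / ((p : ℝ) - 1) - γ) * n ≤ ((G.neighborSet v).ncard : ℝ)) →
        ∃ P : Fin (p - 1) → Set (Fin n),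
          (Pairwise fun i j => Disjoint (P i) (P j)) ∧ (⋃ i, P i) = Set.univ ∧
          ∀ i, ∀ v ∈ P i, degIn G v (P i) ≤ a - 1 := by
  classical
  obtain ⟨s, rfl⟩ : ∃ s, p = s + 2 := ⟨p - 2, by omega⟩
  obtain ⟨L, C, hL, hC, H⟩ := exists_coloring_of_nonNeighbors_le a s
  have hL' : (0 : ℝ) < L := by exact_mod_cast hL
  have hC' : (1 : ℝ) ≤ C := by exact_mod_cast hC
  have hlogC : 0 ≤ Real.log C := Real.log_nonneg hC'
  refine ⟨1 / (L * (s + 1)), by positivity, 1 / (Real.log C + 1), by positivity, C ^ a, ?_⟩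
  intro n hn b hb hbn G hfree hdeg
  have hn0 : (0 : ℝ) < n := by exact_mod_cast lt_of_lt_of_le (pow_pos hC a) hn
  have hCb : C ^ b ≤ n := by
    have h1 : (b : ℝ) * (Real.log C + 1) ≤ Real.log n := by
      rwa [one_div, inv_mul_eq_div, le_div_iff₀ (by positivity)] at hbn
    have h2 : Real.log ((C : ℝ) ^ b) ≤ Real.log n := by
      rw [Real.log_pow]
      nlinarith [(Nat.cast_nonneg b : (0 : ℝ) ≤ b)]
    have h3 := (Real.log_le_log_iff (by positivity) hn0).mp h2
    exact_mod_cast h3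
  have hCmax : C ^ max b a ≤ n := by
    rcases max_choice b a with h | h <;> rw [h] <;> assumption
  obtain ⟨φ, hφ⟩ := H G (max b a) (hb.trans (le_max_left _ _)) (le_max_right _ _)
    (by simpa using hCmax)
    (fun h => hfree (hasCopy_KMulti_mono (fun i => by
      split_ifs
      · exact le_rfl
      · exact le_rfl
      · exact le_max_left _ _) h))
    (fun v => by
      have h1 := card_filter_adj_add_card_nonNeighbors G v Finset.univ
      have h2 : (G.neighborSet v).ncard = (Finset.univ.filter (G.Adj v)).card := by
        rw [← Set.ncard_coe_finset]
        congr 1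
        ext u
        simp
      have h3 := hdeg v
      rw [h2] at h3
      simp only [Finset.card_univ, Fintype.card_fin] at h1 ⊢
      have h4 : ((Finset.univ.filter (G.Adj v)).card : ℝ) +
          (nonNeighbors G v Finset.univ).card = n := by exact_mod_cast h1
      have h5 : ((nonNeighbors G v Finset.univ).card : ℝ) ≤
          (1 / ((s : ℝ) + 1) + 1 / (L * (s + 1))) * n := by
        push_cast at h3
        have h6 : (s : ℝ) + 2 - 1 = s + 1 := by ring
        rw [h6] at h3
        linarith
      have h7 : (L : ℝ) * (s + 1) * (nonNeighbors G v Finset.univ).card ≤ (L + 1) * n := by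
        calc (L : ℝ) * (s + 1) * (nonNeighbors G v Finset.univ).card
            ≤ L * (s + 1) * ((1 / ((s : ℝ) + 1) + 1 / (L * (s + 1))) * n) := by gcongr
          _ = (L + 1) * n := by field_simp
      exact_mod_cast h7)
  refine ⟨fun i => {v | φ v = i}, fun i j hij => ?_, ?_, fun i v hv => ?_⟩
  · exact Set.disjoint_left.mpr fun v hv hv' => hij (hv.symm.trans hv')
  · ext v
    simp
  · have h1 := hφ v
    have h2 : degIn G v {u | φ u = i} =
        (Finset.univ.filter fun u => φ u = φ v ∧ G.Adj v u).card := by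
      rw [degIn, ← Set.ncard_coe_finset]
      congr 1
      ext u
      simp [show φ v = i from hv]
    rw [h2]
    omega
end

section
/- For all integers k ≥ 1, a ≥ 1, p ≥ 2 and every α > 0 there exists μ₀ > 0 such that for every 0 < μ ≤ μ₀ there exist δ > 0 and n₀ with the following property for all n ≥ n₀ and every integer b with 1 ≤ b ≤ δ·ln n: if G is a graph on N ≥ (p − 1 − μ)n vertices such that G is K_p(1,a,b,…,b)-free (where K_p(1,a,b,…,b) is the complete p-partite graph with one part of size 1, one part of size a, and p−2 parts of size b) and the complement of G contains no B_{k,n}, then all but at most αN vertices of G have degree at least (1 − 1/(p−1) − α)N. -/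
open SimpleGraph

section Preliminaries

open Finset
open scoped Classical

variable {V : Type*}

/-- The number of vertices of `A` that are equal or non-adjacent to `v`. -/
noncomputable def nonNbrCount (G : SimpleGraph V) (v : V) (A : Finset V) : ℕ :=
  #{u ∈ A | ¬ G.Adj v u}

lemma nonNbrCount_le (G : SimpleGraph V) (v : V) (A : Finset V) : nonNbrCount G v A ≤ #A :=
  card_filter_le _ _

lemma card_nbr_add_nonNbrCount (G : SimpleGraph V) (v : V) (A : Finset V) :
    #{u ∈ A | G.Adj v u} + nonNbrCount G v A = #A :=
  card_filter_add_card_filter_not _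

/-- Completely joined vertex sets that are large enough span a complete multipartite graph. -/
lemma hasCopy_KMulti {p : ℕ} (G : SimpleGraph V) (a : Fin p → ℕ) (B : Fin p → Finset V)
    (hcard : ∀ i, a i ≤ #(B i))
    (hadj : ∀ i j, i ≠ j → ∀ x ∈ B i, ∀ y ∈ B j, G.Adj x y) : HasCopy G (KMulti a) := by
  have hemb : ∀ i, ∃ e : Fin (a i) → V, Function.Injective e ∧ ∀ x, e x ∈ B i := by
    intro i
    refine ⟨fun x => ((B i).equivFin.symm (Fin.castLE (hcard i) x) : V), ?_, fun x => ?_⟩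
    · intro x y h
      simpa using (B i).equivFin.symm.injective (Subtype.ext h)
    · exact ((B i).equivFin.symm _).2
  choose e he heB using hemb
  refine ⟨⟨fun x => e x.1 x.2, ?_⟩, ?_⟩
  · intro x y hxy
    exact hadj _ _ hxy _ (heB _ _) _ (heB _ _)
  · rintro ⟨i, x⟩ ⟨j, y⟩ h
    by_cases hij : i = j
    · subst hij
      exact congrArg (Sigma.mk i) (he i h)
    · exact absurd h (hadj i j hij _ (heB _ _) _ (heB _ _)).ne

/-- If the complement of `G` has no `B_{k,n}`, then an independent `k`-set of `G` has at most `n`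
common non-neighbours. -/
lemma card_common_nonNbr_le [Fintype V] {k n : ℕ} (G : SimpleGraph V) (hB : ¬ HasCopy Gᶜ (Book k n))
    (f : Fin k → V) (hf : ∀ i j, i ≠ j → Gᶜ.Adj (f i) (f j)) :
    #{v | ∀ j, ¬ G.Adj v (f j)} ≤ n := by
  by_contra! hcon
  set S : Finset V := {v | ∀ j, Gᶜ.Adj v (f j)}
  have hsub : ({v | ∀ j, ¬ G.Adj v (f j)} : Finset V) ⊆ S ∪ univ.image f := by
    intro v hv
    by_cases h : ∃ j, f j = v
    · obtain ⟨j, rfl⟩ := h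
      simp
    · push Not at h
      simp only [mem_filter, mem_univ, true_and] at hv
      simp only [mem_union, S, mem_filter, mem_univ, true_and]
      exact .inl fun j => ⟨fun e => h j e.symm, hv j⟩
  have h1 := (card_le_card hsub).trans (card_union_le _ _)
  have h2 : #(univ.image f) ≤ k := card_image_le.trans (by simp)
  refine hB (hasCopy_KMulti Gᶜ _
    (fun i : Fin (k + 1) => if h : (i : ℕ) < k then {f ⟨i, h⟩} else S) ?_ ?_)
  · intro i
    by_cases h : (i : ℕ) < k
    · simp [h]
    · simp only [h, if_false, dif_neg, not_false_eq_true]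
      omega
  · intro i j hij x hx y hy
    by_cases hi : (i : ℕ) < k <;> by_cases hj : (j : ℕ) < k <;>
      simp only [hi, hj, dif_pos, dif_neg, not_false_eq_true, mem_singleton, S, mem_filter,
        mem_univ, true_and] at hx hy
    · subst hx hy
      exact hf _ _ (by simpa [Fin.ext_iff] using hij)
    · subst hx
      exact (hy _).symm
    · subst hy
      exact hx _
    · exact absurd (Fin.ext (by omega)) hij

lemma card_filter_rel_le {k : ℕ} (A : Finset V) (R : V → V → Prop) (D : ℕ)
    (hD : ∀ x ∈ A, #{u ∈ A | R x u} ≤ D) (i j : Fin k) (hij : i ≠ j) :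
    #{f ∈ Fintype.piFinset fun _ : Fin k => A | R (f i) (f j)} ≤ D * #A ^ (k - 1) := by
  set s := {f ∈ Fintype.piFinset fun _ : Fin k => A | R (f i) (f j)}
  let g : (Fin k → V) → ({l : Fin k // l ≠ j} → V) := fun f l => f l
  have hmaps : ∀ f ∈ s, g f ∈ Fintype.piFinset fun _ : {l : Fin k // l ≠ j} => A := by
    intro f hf
    simp only [s, mem_filter, Fintype.mem_piFinset] at hf ⊢
    exact fun l => hf.1 l
  have hfib : ∀ h ∈ Fintype.piFinset fun _ : {l : Fin k // l ≠ j} => A,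
      #{f ∈ s | g f = h} ≤ D := by
    intro h hh
    rw [Fintype.mem_piFinset] at hh
    refine le_trans (card_le_card_of_injOn (fun f => f j) ?_ ?_) (hD _ (hh ⟨i, hij⟩))
    · intro f hf
      simp only [s, mem_coe, mem_filter, Fintype.mem_piFinset] at hf ⊢
      refine ⟨hf.1.1 j, ?_⟩
      rw [← hf.2]
      exact hf.1.2
    · intro f hf f' hf' hff
      simp only [mem_coe, mem_filter] at hf hf'
      funext l
      by_cases hl : l = j
      · subst hl; exact hff
      · exact congrFun (hf.2.trans hf'.2.symm) ⟨l, hl⟩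
  have := card_le_mul_card_image_of_maps_to hmaps D hfib
  simpa using this

/-- The `k`-th power moment of the non-neighbour counts into a nearly independent set. -/
lemma sum_nonNbrCount_pow_le [Fintype V] {k n : ℕ} (G : SimpleGraph V)
    (hB : ¬ HasCopy Gᶜ (Book k n)) (A : Finset V) (D : ℕ) (hD : ∀ x ∈ A, #{u ∈ A | x = u ∨ G.Adj x u} ≤ D) :
    ∑ v, nonNbrCount G v A ^ k ≤
      n * #A ^ k + k ^ 2 * (D * #A ^ (k - 1)) * Fintype.card V := by
  set F := Fintype.piFinset fun _ : Fin k => A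
  have hF : #F = #A ^ k := by simp [F]
  have h1 : ∑ v, nonNbrCount G v A ^ k = ∑ f ∈ F, #{v | ∀ j, ¬ G.Adj v (f j)} := by
    have : ∀ v, nonNbrCount G v A ^ k = #{f ∈ F | ∀ j, ¬ G.Adj v (f j)} := by
      intro v
      have : ({f ∈ F | ∀ j, ¬ G.Adj v (f j)} : Finset (Fin k → V)) =
          Fintype.piFinset fun _ : Fin k => {u ∈ A | ¬ G.Adj v u} := by
        ext f
        simp [F, Fintype.mem_piFinset, forall_and]
      rw [this]
      simp [nonNbrCount]
    simp_rw [this]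
    exact sum_card_bipartiteAbove_eq_sum_card_bipartiteBelow
      (fun v (f : Fin k → V) => ∀ j, ¬ G.Adj v (f j))
  set bad := {f ∈ F | ∃ ij : Fin k × Fin k,
    ij.1 ≠ ij.2 ∧ (f ij.1 = f ij.2 ∨ G.Adj (f ij.1) (f ij.2))}
  have hbad : #bad ≤ k ^ 2 * (D * #A ^ (k - 1)) := by
    have hsub : bad ⊆ (univ.filter fun ij : Fin k × Fin k => ij.1 ≠ ij.2).biUnion fun ij =>
        {f ∈ F | f ij.1 = f ij.2 ∨ G.Adj (f ij.1) (f ij.2)} := by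
      intro f hf
      simp only [bad, mem_filter] at hf
      obtain ⟨hf, ij, hij, h⟩ := hf
      simp only [mem_biUnion, mem_filter, mem_univ, true_and]
      exact ⟨ij, hij, hf, h⟩
    refine (card_le_card hsub).trans ((card_biUnion_le_card_mul _ _ (D * #A ^ (k - 1)) ?_).trans ?_)
    · intro ij hij
      convert card_filter_rel_le A (fun x u => x = u ∨ G.Adj x u) D
        (fun x hx => by convert hD x hx) _ _ (mem_filter.1 hij).2
    · refine Nat.mul_le_mul_right _ ((card_filter_le _ _).trans ?_)
      simp [sq]
  rw [h1, ← sum_filter_add_sum_filter_not F (fun f => f ∈ bad)]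
  rw [add_comm]
  refine Nat.add_le_add ?_ ?_
  · refine (sum_le_card_nsmul _ _ n ?_).trans ?_
    · intro f hf
      simp only [bad, mem_filter, not_and, not_exists] at hf
      refine card_common_nonNbr_le G hB f fun i j hij => ?_
      have := hf.2 hf.1 (i, j) hij
      push Not at this
      exact ⟨this.1, this.2⟩
    · rw [smul_eq_mul, mul_comm, ← hF]
      exact Nat.mul_le_mul_left _ (card_filter_le _ _)
  · refine (sum_le_card_nsmul _ _ (Fintype.card V) ?_).trans ?_
    · intro f _
      exact card_le_univ _
    · rw [smul_eq_mul]
      refine Nat.mul_le_mul_right _ (le_trans (card_le_card ?_) hbad)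
      intro f hf
      exact (mem_filter.1 hf).2

/-- A quantitative form of Ramsey's theorem. -/
lemma exists_clique_or_indep (G : SimpleGraph V) (s m : ℕ) (X : Finset V)
    (hX : 2 ^ (s + m) ≤ #X) :
    (∃ S ⊆ X, #S = s ∧ ∀ x ∈ S, ∀ y ∈ S, x ≠ y → G.Adj x y) ∨
      ∃ I ⊆ X, #I = m ∧ ∀ x ∈ I, ∀ y ∈ I, ¬ G.Adj x y := by
  induction hl : s + m generalizing s m X with
  | zero =>
    exact .inl ⟨∅, by simp, by simp; omega, by simp⟩
  | succ l ih =>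
    rcases s with _ | s
    · exact .inl ⟨∅, by simp, by simp, by simp⟩
    rcases m with _ | m
    · exact .inr ⟨∅, by simp, by simp, by simp⟩
    rw [hl, pow_succ] at hX
    obtain ⟨v, hv⟩ : X.Nonempty := card_pos.1 ((by positivity : 0 < 2 ^ l * 2).trans_le hX)
    have hsplit : #{u ∈ X.erase v | G.Adj v u} + #{u ∈ X.erase v | ¬ G.Adj v u} = #(X.erase v) :=
      card_filter_add_card_filter_not _
    rw [card_erase_of_mem hv] at hsplit
    have hpos := Nat.one_le_two_pow (n := l)
    rcases le_or_gt (2 ^ l) #{u ∈ X.erase v | G.Adj v u} with h | h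
    · rcases ih s (m + 1) {u ∈ X.erase v | G.Adj v u}
        (by rwa [show s + (m + 1) = l by omega]) (by omega)
        with ⟨S, hS, hc, hadj⟩ | ⟨I, hI, hc, hadj⟩
      · left
        have hvS : ∀ u ∈ S, G.Adj v u := fun u hu => (mem_filter.1 (hS hu)).2
        refine ⟨insert v S, ?_, ?_, ?_⟩
        · refine insert_subset hv (hS.trans ((filter_subset _ _).trans (erase_subset _ _)))
        · rw [card_insert_of_notMem (fun h => (hvS v h).ne rfl), hc]
        · intro x hx y hy hxy
          rcases mem_insert.1 hx with rfl | hx' <;> rcases mem_insert.1 hy with rfl | hy'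
          · exact absurd rfl hxy
          · exact hvS _ hy'
          · exact (hvS _ hx').symm
          · exact hadj x hx' y hy' hxy
      · exact .inr ⟨I, hI.trans ((filter_subset _ _).trans (erase_subset _ _)), hc, hadj⟩
    · rcases ih (s + 1) m {u ∈ X.erase v | ¬ G.Adj v u}
        (by rw [show s + 1 + m = l by omega]; omega) (by omega)
        with ⟨S, hS, hc, hadj⟩ | ⟨I, hI, hc, hadj⟩
      · exact .inl ⟨S, hS.trans ((filter_subset _ _).trans (erase_subset _ _)), hc, hadj⟩
      · right
        have hvI : ∀ u ∈ I, u ≠ v ∧ ¬ G.Adj v u := fun u hu =>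
          ⟨(mem_erase.1 (mem_filter.1 (hI hu)).1).1, (mem_filter.1 (hI hu)).2⟩
        refine ⟨insert v I, ?_, ?_, ?_⟩
        · refine insert_subset hv (hI.trans ((filter_subset _ _).trans (erase_subset _ _)))
        · rw [card_insert_of_notMem (fun h => (hvI v h).1 rfl), hc]
        · intro x hx y hy
          rcases mem_insert.1 hx with rfl | hx' <;> rcases mem_insert.1 hy with rfl | hy'
          · exact G.irrefl
          · exact (hvI _ hy').2
          · exact fun h => (hvI _ hx').2 h.symm
          · exact hadj x hx' y hy'

/-- Pigeonholing: many vertices, each related to at least `m` elements of every `A i`, contain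
many vertices that are related to the same `m`-subsets. -/
lemma exists_common_subsets {q M m c : ℕ} (A : Fin q → Finset V) (hA : ∀ i, #(A i) = M)
    (R : V → V → Prop) (X : Finset V) (hR : ∀ v ∈ X, ∀ i, m ≤ #{u ∈ A i | R v u}) (hc : 0 < c)
    (hX : 2 ^ (q * M) * c ≤ #X) :
    ∃ B : Fin q → Finset V, ∃ Y ⊆ X, c ≤ #Y ∧ (∀ i, B i ⊆ A i ∧ #(B i) = m) ∧
      ∀ v ∈ Y, ∀ i, ∀ u ∈ B i, R v u := by
  have hB : ∀ v, ∃ B : Fin q → Finset V, v ∈ X → ∀ i, B i ⊆ {u ∈ A i | R v u} ∧ #(B i) = m := by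
    intro v
    by_cases hv : v ∈ X
    · choose B hB using fun i => exists_subset_card_eq (hR v hv i)
      exact ⟨B, fun _ => hB⟩
    · exact ⟨fun _ => ∅, fun h => absurd h hv⟩
  choose B hB using hB
  have hmaps : ∀ v ∈ X, B v ∈ Fintype.piFinset fun i => (A i).powerset := by
    intro v hv
    rw [Fintype.mem_piFinset]
    exact fun i => mem_powerset.2 ((hB v hv i).1.trans (filter_subset _ _))
  have hcard : #(Fintype.piFinset fun i => (A i).powerset) = 2 ^ (q * M) := by
    simp [hA, ← pow_mul, mul_comm]
  obtain ⟨B₀, -, hB₀⟩ := exists_le_card_fiber_of_mul_le_card_of_maps_to hmaps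
    (card_pos.1 (by rw [hcard]; positivity)) (hcard.symm ▸ hX)
  obtain ⟨v₀, hv₀⟩ := card_pos.1 (hc.trans_le hB₀)
  rw [mem_filter] at hv₀
  refine ⟨B₀, {v ∈ X | B v = B₀}, filter_subset _ _, hB₀, fun i => ?_, ?_⟩
  · rw [← hv₀.2]
    exact ⟨(hB v₀ hv₀.1 i).1.trans (filter_subset _ _), (hB v₀ hv₀.1 i).2⟩
  · intro v hv i u hu
    rw [mem_filter] at hv
    rw [← hv.2] at hu
    exact (mem_filter.1 ((hB v hv.1 i).1 hu)).2

lemma hasCopy_of_clique {W : Type*} [Fintype W] (G : SimpleGraph V) (H : SimpleGraph W)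
    (S : Finset V) (hS : ∀ x ∈ S, ∀ y ∈ S, x ≠ y → G.Adj x y) (hcard : Fintype.card W ≤ #S) :
    HasCopy G H := by
  obtain ⟨e⟩ := Function.Embedding.nonempty_of_card_le
    (α := W) (β := S) (by simpa using hcard)
  have he : Function.Injective fun w => (e w : V) := Subtype.val_injective.comp e.injective
  exact ⟨⟨fun w => e w, fun {x y} h => hS _ (e x).2 _ (e y).2 (he.ne h.ne)⟩, he⟩

/-- The sets `A i` are independent, of size `M`, and completely joined to each other. -/
structure IsBlowup (G : SimpleGraph V) {q : ℕ} (M : ℕ) (A : Fin q → Finset V) : Prop where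
  card_eq : ∀ i, #(A i) = M
  not_adj : ∀ i, ∀ x ∈ A i, ∀ y ∈ A i, ¬ G.Adj x y
  adj : ∀ i j, i ≠ j → ∀ x ∈ A i, ∀ y ∈ A j, G.Adj x y

/-- A maximal blow-up: few vertices have many neighbours in every part. -/
lemma exists_maximal_blowup [Fintype V] {p a b t D : ℕ} (G : SimpleGraph V) (ht : 1 ≤ t)
    (hat : a ≤ t) (hbt : b ≤ t) (hD : 1 ≤ D)
    (hfree : ¬ HasCopy G (KMulti (fun i : Fin p =>
      if (i : ℕ) = 0 then 1 else if (i : ℕ) = 1 then a else b))) :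
    ∃ q < p, ∃ A : Fin q → Finset V, IsBlowup G (D ^ (p - q) * t) A ∧
      #{v | ∀ i, D ^ (p - q - 1) * t ≤ #{u ∈ A i | G.Adj v u}} ≤
        2 ^ ((p * D ^ p + p + D ^ p) * t) := by
  set parts : Fin p → ℕ := fun i => if (i : ℕ) = 0 then 1 else if (i : ℕ) = 1 then a else b
    with hparts
  have hle : ∀ i, parts i ≤ t := by
    intro i
    simp only [hparts]
    split_ifs <;> assumption
  let P : ℕ → Prop := fun q => ∃ A : Fin q → Finset V, IsBlowup G (D ^ (p - q) * t) A
  have hP0 : P 0 := ⟨fun i => i.elim0, fun i => i.elim0, fun i => i.elim0, fun i => i.elim0⟩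
  have hPp : ¬ P p := by
    rintro ⟨A, hA⟩
    refine hfree (hasCopy_KMulti G _ A (fun i => ?_) hA.adj)
    rw [hA.card_eq]
    simpa using hle i
  obtain ⟨q, hqp, ⟨A, hA⟩, hq⟩ : ∃ q < p, P q ∧ ¬ P (q + 1) := by
    by_contra! hcon
    have : ∀ q ≤ p, P q := by
      intro q
      induction q with
      | zero => exact fun _ => hP0
      | succ q ih => exact fun h => hcon q h (ih (by omega))
    exact hPp (this p le_rfl)
  refine ⟨q, hqp, A, hA, ?_⟩
  by_contra! hcon
  have hexp : 2 ^ (q * (D ^ (p - q) * t)) * 2 ^ (p * t + D ^ (p - q - 1) * t) ≤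
      2 ^ ((p * D ^ p + p + D ^ p) * t) := by
    rw [← pow_add]
    refine Nat.pow_le_pow_right (by norm_num) ?_
    have h1 : D ^ (p - q) ≤ D ^ p := Nat.pow_le_pow_right hD (by omega)
    have h2 : D ^ (p - q - 1) ≤ D ^ p := Nat.pow_le_pow_right hD (by omega)
    have h3 : q * (D ^ (p - q) * t) ≤ p * (D ^ p * t) := by gcongr
    have h4 : D ^ (p - q - 1) * t ≤ D ^ p * t := by gcongr
    linarith
  obtain ⟨B, Y, -, hY, hB, hYB⟩ := exists_common_subsets A hA.card_eq G.Adj _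
    (fun v hv => (mem_filter.1 hv).2) (by positivity) (hexp.trans hcon.le)
  rcases exists_clique_or_indep G _ _ Y hY with ⟨S, -, hSc, hS⟩ | ⟨I, hIY, hIc, hI⟩
  · refine hfree (hasCopy_of_clique G _ S hS ?_)
    rw [hSc, Fintype.card_sigma]
    simpa using sum_le_card_nsmul univ parts t fun i _ => hle i
  · refine hq ⟨Fin.cons I B, ?_, ?_, ?_⟩
    · rw [← Nat.sub_sub]
      exact Fin.cases hIc fun i => (hB i).2
    · exact Fin.cases hI fun i x hx y hy =>
        hA.not_adj i x ((hB i).1 hx) y ((hB i).1 hy)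
    · refine Fin.cases (Fin.cases (fun h => absurd rfl h) fun j _ x hx y hy => ?_)
        fun i => Fin.cases (fun _ x hx y hy => ?_) fun j hij x hx y hy => ?_
      · exact hYB x (hIY hx) j y hy
      · exact (hYB y (hIY hy) i x hx).symm
      · exact hA.adj i j (fun h => hij (h ▸ rfl)) x ((hB i).1 hx) y ((hB j).1 hy)

/-- Vertices that are joined to most of all but one part of a blow-up span few edges. -/
lemma card_nbr_le_of_blowup {s a b M : ℕ} (G : SimpleGraph V) (ha : 1 ≤ a)
    (hfree : ¬ HasCopy G (KMulti (fun i : Fin (s + 2) =>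
      if (i : ℕ) = 0 then 1 else if (i : ℕ) = 1 then a else b)))
    (A : Fin (s + 1) → Finset V) (hA : IsBlowup G M A) (hM : 2 * b ≤ M) (i : Fin (s + 1))
    (X : Finset V) (hX : ∀ u ∈ X, ∀ j, j ≠ i → 4 * nonNbrCount G u (A j) ≤ M)
    (v : V) (hv : v ∈ X) : #{u ∈ X | G.Adj v u} ≤ 2 ^ (s * M) * a := by
  by_contra! hcon
  have hcommon : ∀ u ∈ ({u ∈ X | G.Adj v u} : Finset V), ∀ j : Fin s,
      b ≤ #{w ∈ A (i.succAbove j) | G.Adj u w ∧ G.Adj v w} := by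
    intro u hu j
    have h1 := hX u (mem_filter.1 hu).1 _ (i.succAbove_ne j)
    have h2 := hX v hv _ (i.succAbove_ne j)
    have h3 : A (i.succAbove j) ⊆ {w ∈ A (i.succAbove j) | G.Adj u w ∧ G.Adj v w} ∪
        ({w ∈ A (i.succAbove j) | ¬ G.Adj u w} ∪ {w ∈ A (i.succAbove j) | ¬ G.Adj v w}) := by
      intro w hw
      simp only [mem_union, mem_filter, hw, true_and]
      tauto
    have h4 := (card_le_card h3).trans ((card_union_le _ _).trans
      (Nat.add_le_add_left (card_union_le _ _) _))
    rw [hA.card_eq] at h4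
    simp only [nonNbrCount] at h1 h2
    omega
  obtain ⟨B, Y, hYX, hY, hB, hYB⟩ := exists_common_subsets (fun j => A (i.succAbove j))
    (fun j => hA.card_eq _) (fun u w => G.Adj u w ∧ G.Adj v w) {u ∈ X | G.Adj v u}
    (fun u hu j => by convert hcommon u hu j) ha hcon.le
  obtain ⟨y₀, hy₀⟩ := card_pos.1 (ha.trans hY)
  have hvY : ∀ y ∈ Y, G.Adj v y := fun y hy => (mem_filter.1 (hYX hy)).2
  have hvB : ∀ j, ∀ w ∈ B j, G.Adj v w := fun j w hw => (hYB y₀ hy₀ j w hw).2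
  have hYB' : ∀ j, ∀ w ∈ B j, ∀ y ∈ Y, G.Adj y w := fun j w hw y hy => (hYB y hy j w hw).1
  refine hfree (hasCopy_KMulti G _
    (Fin.cons {v} (Fin.cons Y B : Fin (s + 1) → Finset V)) ?_ ?_)
  · refine Fin.cases (by simp) (Fin.cases (by simpa using hY) fun j => ?_)
    simp [(hB j).2]
  · refine Fin.cases (Fin.cases (fun h => absurd rfl h) (Fin.cases ?_ fun j => ?_))
      (Fin.cases (Fin.cases ?_ (Fin.cases (fun h => absurd rfl h) fun j => ?_))
        fun l => Fin.cases ?_ (Fin.cases ?_ fun j => ?_)) <;> intro hne x hx y hy <;>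
      simp only [Fin.cons_zero, Fin.cons_succ, mem_singleton] at hx hy
    · exact hx ▸ hvY y hy
    · exact hx ▸ hvB j y hy
    · exact hy ▸ (hvY x hx).symm
    · exact hy ▸ (hvB l x hx).symm
    · exact hYB' j y hy x hx
    · exact (hYB' l x hx y hy).symm
    · refine hA.adj _ _ (fun h => hne ?_) x ((hB l).1 hx) y ((hB j).1 hy)
      rw [Fin.succAbove_right_injective h]

/-- Normalised form of `sum_nonNbrCount_pow_le`. -/
lemma sum_nonNbrCount_div_pow_le [Fintype V] {k n : ℕ} (G : SimpleGraph V) (hk : 1 ≤ k)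
    (hB : ¬ HasCopy Gᶜ (Book k n)) (A : Finset V) (hA : 0 < #A) (D : ℕ)
    (hD : ∀ x ∈ A, #{u ∈ A | x = u ∨ G.Adj x u} ≤ D) :
    ∑ v, ((nonNbrCount G v A : ℝ) / #A) ^ k ≤ n + k ^ 2 * D * Fintype.card V / #A := by
  have h := sum_nonNbrCount_pow_le G hB A D hD
  have h' : (∑ v, (nonNbrCount G v A : ℝ) ^ k) ≤
      n * (#A : ℝ) ^ k + k ^ 2 * (D * (#A : ℝ) ^ (k - 1)) * Fintype.card V := by
    exact_mod_cast h
  have hA' : (0 : ℝ) < #A := by exact_mod_cast hA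
  simp_rw [div_pow]
  rw [← sum_div, div_le_iff₀ (by positivity)]
  refine h'.trans (le_of_eq ?_)
  obtain ⟨l, rfl⟩ : ∃ l, k = l + 1 := ⟨k - 1, by omega⟩
  simp only [Nat.add_sub_cancel]
  field_simp
  ring

/-- If every non-exceptional point has a value close to `1` under one of `q` functions, and each
function has average about `1 / (s + 1)`, then there are at least `s + 1` functions. -/
lemma succ_le_of_sum_le [Fintype V] [Nonempty V] {q s : ℕ} {μ : ℝ} (hμ : 0 < μ) (hμ1 : μ ≤ 1)
    (hμs : 4 * μ * (s + 1) < 1) (x : Fin q → V → ℝ) (hx0 : ∀ i v, 0 ≤ x i v)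
    (hsum : ∀ i, ∑ v, x i v ≤ (1 + 2 * μ) * Fintype.card V / (s + 1))
    (E : Finset V) (hE : (#E : ℝ) ≤ μ * Fintype.card V)
    (hcov : ∀ v ∉ E, ∃ i, 1 - μ ≤ x i v) : s + 1 ≤ q := by
  by_contra! hq
  have hq' : (q : ℝ) ≤ s := by exact_mod_cast Nat.lt_succ_iff.1 hq
  have hN : (0 : ℝ) < Fintype.card V := by exact_mod_cast Fintype.card_pos
  have h1 : ∑ i, ∑ v, x i v ≤ q * ((1 + 2 * μ) * Fintype.card V / (s + 1)) := by
    refine (sum_le_sum fun i _ => hsum i).trans (by simp)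
  have h2 : (#Eᶜ : ℝ) * (1 - μ) ≤ ∑ i, ∑ v, x i v := by
    rw [sum_comm]
    calc (#Eᶜ : ℝ) * (1 - μ) = ∑ v ∈ Eᶜ, (1 - μ) := by rw [sum_const, nsmul_eq_mul]
      _ ≤ ∑ v ∈ Eᶜ, ∑ i, x i v := by
        refine sum_le_sum fun v hv => ?_
        obtain ⟨i, hi⟩ := hcov v (mem_compl.1 hv)
        exact hi.trans (single_le_sum (f := fun i => x i v) (fun j _ => hx0 j v) (mem_univ i))
      _ ≤ ∑ v, ∑ i, x i v :=
        sum_le_sum_of_subset_of_nonneg (subset_univ _)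
          fun v _ _ => sum_nonneg fun i _ => hx0 i v
  have h3 : (#Eᶜ : ℝ) = Fintype.card V - #E := by
    rw [card_compl, Nat.cast_sub (card_le_univ _)]
  have h4 : (1 - μ) * Fintype.card V * (1 - μ) ≤
      s * ((1 + 2 * μ) * Fintype.card V / (s + 1)) :=
    calc _ ≤ (#Eᶜ : ℝ) * (1 - μ) := by
          refine mul_le_mul_of_nonneg_right ?_ (by linarith)
          rw [h3]; linarith
      _ ≤ _ := h2.trans h1
      _ ≤ _ := by gcongr
  have h5 : (1 - μ) * (1 - μ) * (s + 1) ≤ s * (1 + 2 * μ) := by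
    have hs : (0 : ℝ) < s + 1 := by positivity
    rw [mul_div_assoc', le_div_iff₀ hs] at h4
    refine le_of_mul_le_mul_right ?_ hN
    linarith
  have hs : (0 : ℝ) ≤ s := by positivity
  nlinarith [mul_nonneg (sq_nonneg μ) hs, sq_nonneg μ, mul_nonneg hμ.le hs]

/-- In the tight case `q = s + 1`, almost all points have exactly one large value, and the
resulting classes are balanced. -/
lemma exists_classes [Fintype V] {k s : ℕ} {μ : ℝ} (hμ : 0 < μ) (hμ1 : μ ≤ 1 / 2)
    (x : Fin (s + 1) → V → ℝ) (hx0 : ∀ i v, 0 ≤ x i v)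
    (hsum : ∀ i, ∑ v, x i v ^ k ≤ (1 + 2 * μ) * Fintype.card V / (s + 1))
    (E : Finset V) (hE : (#E : ℝ) ≤ μ * Fintype.card V)
    (hcov : ∀ v ∉ E, ∃ i, 1 - μ ≤ x i v ^ k) :
    ∃ W : Fin (s + 1) → Finset V, (∀ i j, i ≠ j → Disjoint (W i) (W j)) ∧
      (∀ i, (#(W i) : ℝ) ≤ (1 + 6 * μ) * Fintype.card V / (s + 1)) ∧
      (1 - 5 * 4 ^ k * μ) * Fintype.card V ≤ ∑ i, (#(W i) : ℝ) ∧
      ∀ i, ∀ v ∈ W i, ∀ j, j ≠ i → x j v ≤ 1 / 4 := by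
  have hN : (0 : ℝ) ≤ Fintype.card V := by positivity
  have hx0' : ∀ i v, 0 ≤ x i v ^ k := fun i v => pow_nonneg (hx0 i v) k
  have hcov' : ∀ v, ∃ i, v ∉ E → 1 - μ ≤ x i v ^ k := by
    intro v
    by_cases hv : v ∈ E
    · exact ⟨0, fun h => absurd hv h⟩
    · obtain ⟨i, hi⟩ := hcov v hv
      exact ⟨i, fun _ => hi⟩
  choose c hc using hcov'
  set Z : Finset V := {v | v ∉ E ∧ ∃ j, j ≠ c v ∧ 1 / 4 < x j v}
  have h3 : (#Eᶜ : ℝ) = Fintype.card V - #E := by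
    rw [card_compl, Nat.cast_sub (card_le_univ _)]
  have htotal : ∑ v ∈ Eᶜ, ∑ i, x i v ^ k ≤ (1 + 2 * μ) * Fintype.card V := by
    calc ∑ v ∈ Eᶜ, ∑ i, x i v ^ k ≤ ∑ v, ∑ i, x i v ^ k :=
        sum_le_sum_of_subset_of_nonneg (subset_univ _)
          fun v _ _ => sum_nonneg fun i _ => hx0' i v
      _ = ∑ i, ∑ v, x i v ^ k := sum_comm
      _ ≤ ∑ i : Fin (s + 1), (1 + 2 * μ) * Fintype.card V / (s + 1) :=
        sum_le_sum fun i _ => hsum i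
      _ = (1 + 2 * μ) * Fintype.card V := by
        simp only [sum_const, card_univ, Fintype.card_fin, nsmul_eq_mul]
        push_cast
        field_simp
  have hexcess : ∀ v ∈ Eᶜ, (if v ∈ Z then (1 / 4 : ℝ) ^ k else 0) + (1 - μ) ≤ ∑ i, x i v ^ k := by
    intro v hv
    have hcv := hc v (mem_compl.1 hv)
    split_ifs with hvZ
    · obtain ⟨-, j, hj, hjx⟩ := (mem_filter.1 hvZ).2
      have := add_le_sum (f := fun i => x i v ^ k) (fun i _ => hx0' i v) (mem_univ j)
        (mem_univ (c v)) hj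
      refine le_trans (add_le_add ?_ hcv) this
      exact pow_le_pow_left₀ (by norm_num) hjx.le k
    · rw [zero_add]
      exact hcv.trans (single_le_sum (f := fun i => x i v ^ k) (fun j _ => hx0' j v) (mem_univ _))
  have hZE : Z ⊆ Eᶜ := fun v hv => mem_compl.2 (mem_filter.1 hv).2.1
  have hZcard : (#Z : ℝ) * (1 / 4) ^ k + #Eᶜ * (1 - μ) ≤ (1 + 2 * μ) * Fintype.card V := by
    refine le_trans (le_of_eq ?_) ((sum_le_sum hexcess).trans htotal)
    rw [sum_add_distrib, ← sum_filter, filter_mem_eq_inter, inter_eq_right.2 hZE]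
    simp only [sum_const, nsmul_eq_mul]
  have hZ4 : (#Z : ℝ) ≤ 4 * 4 ^ k * μ * Fintype.card V := by
    have h4 : (#Z : ℝ) * (1 / 4) ^ k ≤ 4 * μ * Fintype.card V := by
      rw [h3] at hZcard
      nlinarith [mul_nonneg (sq_nonneg μ) hN]
    rw [one_div, inv_pow, ← div_eq_mul_inv, div_le_iff₀ (by positivity)] at h4
    linarith
  refine ⟨fun i => {v | v ∉ E ∧ v ∉ Z ∧ c v = i}, ?_, ?_, ?_, ?_⟩
  · intro i j hij
    rw [Finset.disjoint_left]
    intro v hv hv'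
    exact hij ((mem_filter.1 hv).2.2.2.symm.trans (mem_filter.1 hv').2.2.2)
  · intro i
    set W : Finset V := {v | v ∉ E ∧ v ∉ Z ∧ c v = i}
    have h : (#W : ℝ) * (1 - μ) ≤ (1 + 2 * μ) * Fintype.card V / (s + 1) := by
      refine le_trans ?_ (hsum i)
      calc (#W : ℝ) * (1 - μ) = ∑ v ∈ W, (1 - μ) := by rw [sum_const, nsmul_eq_mul]
        _ ≤ ∑ v ∈ W, x i v ^ k := by
          refine sum_le_sum fun v hv => ?_
          obtain ⟨h1, -, h2⟩ := (mem_filter.1 hv).2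
          exact h2 ▸ hc v h1
        _ ≤ _ := sum_le_sum_of_subset_of_nonneg (subset_univ _) fun v _ _ => hx0' i v
    refine le_of_mul_le_mul_right (h.trans ?_) (by linarith : 0 < 1 - μ)
    rw [div_mul_eq_mul_div]
    gcongr ?_ / _
    nlinarith [mul_nonneg (mul_nonneg hμ.le hN) (by linarith : 0 ≤ 3 - 6 * μ)]
  · have hcount : ∑ i, #({v | v ∉ E ∧ v ∉ Z ∧ c v = i} : Finset V) = #(E ∪ Z)ᶜ := by
      rw [card_eq_sum_card_fiberwise (f := c) (t := univ) (by simp)]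
      refine sum_congr rfl fun i _ => ?_
      congr 1
      ext v
      simp [and_assoc]
    have h5 : (Fintype.card V : ℝ) ≤ #(E ∪ Z)ᶜ + (#E + #Z) := by
      have h6 := card_union_le E Z
      have h7 := card_add_card_compl (E ∪ Z)
      exact_mod_cast (by omega : Fintype.card V ≤ #(E ∪ Z)ᶜ + (#E + #Z))
    rw [← Nat.cast_sum, hcount]
    have h8 : μ * Fintype.card V ≤ 4 ^ k * (μ * Fintype.card V) :=
      le_mul_of_one_le_left (by positivity) (one_le_pow₀ (by norm_num))
    linarith
  · intro i v hv j hj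
    by_contra! hlt
    obtain ⟨h1, h2, h3⟩ := (mem_filter.1 hv).2
    exact h2 (mem_filter.2 ⟨mem_univ _, h1, j, by rwa [h3], hlt⟩)

/-- Apart from few vertices, `G` splits into `s + 1` balanced classes that span few edges. -/
lemma exists_sparse_classes [Fintype V] {k a b s t D n : ℕ} {μ : ℝ} (G : SimpleGraph V)
    (hk : 1 ≤ k) (ha : 1 ≤ a) (ht : 1 ≤ t) (hat : a ≤ t) (hbt : b ≤ t)
    (hμ : 0 < μ) (hμ1 : μ ≤ 1 / 2) (hμs : 4 * μ * (s + 1) < 1) (hD : 2 ≤ D) (hDμ : k ≤ μ * D)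
    (htμ : k ^ 2 * (s + 1) ≤ μ * t)
    (hN : (2 : ℝ) ^ (((s + 2) * D ^ (s + 2) + (s + 2) + D ^ (s + 2)) * t) ≤ μ * Fintype.card V)
    (hn : (n : ℝ) ≤ (1 + μ) * Fintype.card V / (s + 1))
    (hfree : ¬ HasCopy G (KMulti (fun i : Fin (s + 2) =>
      if (i : ℕ) = 0 then 1 else if (i : ℕ) = 1 then a else b)))
    (hB : ¬ HasCopy Gᶜ (Book k n)) :
    ∃ W : Fin (s + 1) → Finset V, (∀ i j, i ≠ j → Disjoint (W i) (W j)) ∧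
      (∀ i, (#(W i) : ℝ) ≤ (1 + 6 * μ) * Fintype.card V / (s + 1)) ∧
      (1 - 5 * 4 ^ k * μ) * Fintype.card V ≤ ∑ i, (#(W i) : ℝ) ∧
      ∀ i, ∀ v ∈ W i, #{u ∈ W i | G.Adj v u} ≤
        2 ^ (((s + 2) * D ^ (s + 2) + (s + 2) + D ^ (s + 2)) * t) * a := by
  have hVpos : (0 : ℝ) < Fintype.card V := by
    have : (0 : ℝ) < μ * Fintype.card V := lt_of_lt_of_le (by positivity) hN
    exact pos_of_mul_pos_right this hμ.le
  have : Nonempty V := Fintype.card_pos_iff.1 (by exact_mod_cast hVpos)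
  obtain ⟨q, hq, A, hA, hE⟩ := exists_maximal_blowup G ht hat hbt (by omega : 1 ≤ D) hfree
  set M' := D ^ (s + 2 - q - 1) * t with hM'
  have hM : D ^ (s + 2 - q) * t = D * M' := by
    rw [hM', ← mul_assoc, ← pow_succ', show s + 2 - q - 1 + 1 = s + 2 - q by omega]
  rw [hM] at hA
  have hM't : t ≤ M' := Nat.le_mul_of_pos_left _ (by positivity)
  have hM'pos : 0 < M' := by omega
  have hMt : t ≤ D * M' := hM't.trans (Nat.le_mul_of_pos_left _ (by omega))
  have hMpos : 0 < D * M' := by omega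
  have hMpos' : (0 : ℝ) < (D * M' : ℕ) := by exact_mod_cast hMpos
  set E : Finset V := {v | ∀ i, M' ≤ #{u ∈ A i | G.Adj v u}} with hEdef
  have hEcard : (#E : ℝ) ≤ μ * Fintype.card V := le_trans (by exact_mod_cast hE) hN
  set x : Fin q → V → ℝ := fun i v => nonNbrCount G v (A i) / (D * M' : ℕ) with hx
  have hx0 : ∀ i v, 0 ≤ x i v := fun i v => by positivity
  have hsum : ∀ i, ∑ v, x i v ^ k ≤ (1 + 2 * μ) * Fintype.card V / (s + 1) := by
    intro i
    have h := sum_nonNbrCount_div_pow_le G hk hB (A i) (by rw [hA.card_eq]; exact hMpos) 1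
      (fun y hy => by
        rw [card_le_one]
        have hyu : ∀ u ∈ A i, (y = u ∨ G.Adj y u) → y = u := fun u hu h =>
          h.resolve_right (hA.not_adj i y hy u hu)
        intro u hu w hw
        rw [mem_filter] at hu hw
        exact (hyu u hu.1 hu.2).symm.trans (hyu w hw.1 hw.2))
    rw [hA.card_eq] at h
    refine h.trans ?_
    have h1 : (k : ℝ) ^ 2 * (1 : ℕ) * Fintype.card V / (D * M' : ℕ) ≤
        μ * Fintype.card V / (s + 1) := by
      rw [div_le_div_iff₀ hMpos' (by positivity)]
      have h2 : (t : ℝ) ≤ (D * M' : ℕ) := by exact_mod_cast hMt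
      have h3 : (k : ℝ) ^ 2 * (s + 1) ≤ μ * (D * M' : ℕ) := htμ.trans (by gcongr)
      calc _ = (k : ℝ) ^ 2 * (s + 1) * Fintype.card V := by push_cast; ring
        _ ≤ μ * (D * M' : ℕ) * Fintype.card V := by gcongr
        _ = _ := by ring
    refine (add_le_add hn h1).trans (le_of_eq ?_)
    ring
  have hcov : ∀ v ∉ E, ∃ i, 1 - μ ≤ x i v ^ k := by
    intro v hv
    simp only [hEdef, mem_filter, mem_univ, true_and, not_forall, not_le] at hv
    obtain ⟨i, hi⟩ := hv
    refine ⟨i, ?_⟩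
    have h1 := card_nbr_add_nonNbrCount G v (A i)
    rw [hA.card_eq] at h1
    have hD0 : (0 : ℝ) < D := by positivity
    have h2 : 1 - 1 / (D : ℝ) ≤ x i v := by
      rw [hx]
      dsimp only
      rw [le_div_iff₀ hMpos']
      have h3 : ((D * M' : ℕ) : ℝ) ≤ M' + nonNbrCount G v (A i) := by
        exact_mod_cast (by omega : D * M' ≤ M' + nonNbrCount G v (A i))
      push_cast at h3 ⊢
      have : (1 - 1 / (D : ℝ)) * (D * M') = D * M' - M' := by field_simp
      linarith
    have h3 := one_add_mul_le_pow (a := x i v - 1) (by linarith [hx0 i v]) k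
    rw [add_sub_cancel] at h3
    refine le_trans ?_ h3
    have h4 : (k : ℝ) * (1 / D) ≤ μ := by
      rw [mul_one_div, div_le_iff₀ hD0]
      exact hDμ
    have h5 : (k : ℝ) * (-(1 / D)) ≤ k * (x i v - 1) := by gcongr; linarith
    linarith
  have hsq : s + 1 ≤ q := succ_le_of_sum_le hμ (by linarith) hμs (fun i v => x i v ^ k)
    (fun i v => pow_nonneg (hx0 i v) k) hsum E hEcard hcov
  obtain rfl : q = s + 1 := by omega
  obtain ⟨W, hW1, hW2, hW3, hW4⟩ := exists_classes hμ hμ1 x hx0 hsum E hEcard hcov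
  refine ⟨W, hW1, hW2, hW3, fun i v hv => ?_⟩
  have hMb : 2 * b ≤ D * M' := Nat.mul_le_mul hD (hbt.trans hM't)
  refine (card_nbr_le_of_blowup G ha hfree A hA hMb i (W i) ?_ v hv).trans ?_
  · intro u hu j hj
    have h := hW4 i u hu j hj
    rw [hx] at h
    dsimp only at h
    rw [div_le_iff₀ hMpos'] at h
    exact_mod_cast (by linarith : 4 * (nonNbrCount G u (A j) : ℝ) ≤ (D * M' : ℕ))
  · refine Nat.mul_le_mul_right _ (Nat.pow_le_pow_right (by norm_num) ?_)
    have h1 : D * M' = D * t := by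
      rw [hM', show s + 2 - (s + 1) - 1 = 0 by omega, pow_zero, one_mul]
    have h2 : D ≤ D ^ (s + 2) := Nat.le_self_pow (by omega) D
    rw [h1]
    calc s * (D * t) ≤ (s + 2) * (D ^ (s + 2) * t) := by gcongr; omega
      _ = (s + 2) * D ^ (s + 2) * t := by ring
      _ ≤ _ := by gcongr; omega

/-- Few vertices of a large sparse class have many non-neighbours outside the class. -/
lemma card_many_outside_nonNbr_le [Fintype V] {k K n : ℕ} {η β γ : ℝ} (G : SimpleGraph V)
    (hk : 1 ≤ k) (hB : ¬ HasCopy Gᶜ (Book k n)) (W : Finset V) (hW : 0 < #W)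
    (hβ : 0 < β) (hKW : ∀ v ∈ W, #{u ∈ W | G.Adj v u} ≤ K)
    (hexcess : (n : ℝ) + k ^ 2 * (K + 1) * Fintype.card V / #W - (#W - k * (K + 1)) ≤
      η * Fintype.card V)
    (hη : η ≤ β ^ (k + 1)) :
    γ * (#{v ∈ W | γ * Fintype.card V < nonNbrCount G v Wᶜ} : ℝ) ≤ 2 * β * #W := by
  have hW' : (0 : ℝ) < #W := by exact_mod_cast hW
  rcases isEmpty_or_nonempty V with hV | hV
  · rw [eq_empty_of_isEmpty W] at hW
    simp at hW
  have hN : (0 : ℝ) < Fintype.card V := by exact_mod_cast Fintype.card_pos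
  set y : V → ℝ := fun v => nonNbrCount G v W / #W with hy
  have hy0 : ∀ v, 0 ≤ y v := fun v => by positivity
  have hy1 : ∀ v, y v ≤ 1 := fun v => by
    rw [hy]
    dsimp only
    rw [div_le_one hW']
    exact_mod_cast nonNbrCount_le G v W
  have hloop : ∀ v ∈ W, #{u ∈ W | v = u ∨ G.Adj v u} ≤ K + 1 := by
    intro v hv
    have : ({u ∈ W | v = u ∨ G.Adj v u} : Finset V) ⊆ insert v {u ∈ W | G.Adj v u} := by
      intro u hu
      rw [mem_filter] at hu
      rcases hu.2 with rfl | h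
      · simp
      · simp [hu.1, h]
    exact (card_le_card this).trans ((card_insert_le _ _).trans (Nat.add_le_add_right (hKW v hv) 1))
  have hall := sum_nonNbrCount_div_pow_le G hk hB W hW (K + 1) (fun v hv => by convert hloop v hv)
  have hin : (#W : ℝ) - k * (K + 1) ≤ ∑ v ∈ W, y v ^ k := by
    have h1 : ∀ v ∈ W, 1 - k * ((K + 1) / #W) ≤ y v ^ k := by
      intro v hv
      have h2 := one_add_mul_le_pow (a := y v - 1) (by linarith [hy0 v]) k
      rw [add_sub_cancel] at h2
      refine le_trans ?_ h2
      have h3 : 1 - (K + 1) / (#W : ℝ) ≤ y v := by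
        rw [hy]
        dsimp only
        rw [le_div_iff₀ hW', sub_mul, div_mul_cancel₀ _ hW'.ne', one_mul]
        have h4 := card_nbr_add_nonNbrCount G v W
        have h5 := hKW v hv
        have : (#W : ℝ) ≤ K + nonNbrCount G v W := by
          exact_mod_cast (by omega : #W ≤ K + nonNbrCount G v W)
        linarith
      have h4 : (k : ℝ) * (-((K + 1) / #W)) ≤ k * (y v - 1) := by gcongr; linarith
      linarith
    refine le_trans (le_of_eq ?_) (sum_le_sum h1)
    rw [sum_const, nsmul_eq_mul]
    field_simp
  have hout : ∑ v ∈ Wᶜ, y v ^ k ≤ η * Fintype.card V := by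
    have h := sum_add_sum_compl W fun v => y v ^ k
    push_cast at hall
    linarith
  have hlin : ∑ v ∈ Wᶜ, y v ≤ 2 * β * Fintype.card V := by
    have h1 : ∀ v ∈ Wᶜ, y v ≤ β + y v ^ k / β ^ k := by
      intro v _
      rcases le_or_gt (y v) β with h | h
      · have := hy0 v
        have : 0 ≤ y v ^ k / β ^ k := by positivity
        linarith
      · have : 1 ≤ y v ^ k / β ^ k := by
          rw [one_le_div (by positivity)]
          exact pow_le_pow_left₀ hβ.le h.le k
        linarith [hy1 v]
    refine (sum_le_sum h1).trans ?_
    rw [sum_add_distrib, ← sum_div, sum_const, nsmul_eq_mul]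
    have h2 : (#Wᶜ : ℝ) * β ≤ Fintype.card V * β := by
      gcongr
      exact card_le_univ _
    have h3 : (∑ v ∈ Wᶜ, y v ^ k) / β ^ k ≤ β * Fintype.card V := by
      rw [div_le_iff₀ (by positivity)]
      calc _ ≤ η * Fintype.card V := hout
        _ ≤ β ^ (k + 1) * Fintype.card V := by gcongr
        _ = _ := by ring
    linarith
  have hdouble : ∑ v ∈ W, nonNbrCount G v Wᶜ = ∑ v ∈ Wᶜ, nonNbrCount G v W := by
    have h := sum_card_bipartiteAbove_eq_sum_card_bipartiteBelow (s := W) (t := Wᶜ)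
      (fun v u => ¬ G.Adj v u)
    simp only [bipartiteAbove, bipartiteBelow] at h
    simp only [nonNbrCount]
    convert h using 5
    rw [G.adj_comm]
  set bad : Finset V := {v ∈ W | γ * Fintype.card V < nonNbrCount G v Wᶜ}
  have hbad : (#bad : ℝ) * (γ * Fintype.card V) ≤ #W * (2 * β * Fintype.card V) := by
    calc (#bad : ℝ) * (γ * Fintype.card V) = ∑ v ∈ bad, γ * Fintype.card V := by
          rw [sum_const, nsmul_eq_mul]
      _ ≤ ∑ v ∈ bad, (nonNbrCount G v Wᶜ : ℝ) := sum_le_sum fun v hv => (mem_filter.1 hv).2.le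
      _ ≤ ∑ v ∈ W, (nonNbrCount G v Wᶜ : ℝ) :=
        sum_le_sum_of_subset_of_nonneg (filter_subset _ _) fun _ _ _ => by positivity
      _ = ∑ v ∈ Wᶜ, (nonNbrCount G v W : ℝ) := by exact_mod_cast hdouble
      _ = #W * ∑ v ∈ Wᶜ, y v := by
        rw [mul_sum]
        refine sum_congr rfl fun v _ => ?_
        rw [hy]
        field_simp
      _ ≤ _ := by gcongr
  refine le_of_mul_le_mul_right ?_ hN
  linarith

/-- Balanced sparse classes covering almost everything force almost all degrees to be large. -/
lemma card_low_degree_le [Fintype V] {k K s n : ℕ} {α μ : ℝ} (G : SimpleGraph V)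
    (hk : 1 ≤ k) (hα : 0 < α) (hμ : 0 < μ)
    (hμα : 6 * μ ≤ α / 2) (hμα' : 5 * 4 ^ k * μ ≤ α / 2)
    (hμs : 2 * (s + 1) * (5 * 4 ^ k + 6) * μ ≤ 1)
    (hμβ : (5 * 4 ^ k + 9) * μ ≤ (α ^ 2 / 8) ^ (k + 1))
    (hn : (n : ℝ) ≤ (1 + μ) * Fintype.card V / (s + 1))
    (hK : 2 * (s + 1) * k ^ 2 * (K + 1) ≤ μ * Fintype.card V)
    (hB : ¬ HasCopy Gᶜ (Book k n))
    (W : Fin (s + 1) → Finset V) (hdisj : ∀ i j, i ≠ j → Disjoint (W i) (W j))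
    (hW : ∀ i, (#(W i) : ℝ) ≤ (1 + 6 * μ) * Fintype.card V / (s + 1))
    (hcov : (1 - 5 * 4 ^ k * μ) * Fintype.card V ≤ ∑ i, (#(W i) : ℝ))
    (hKW : ∀ i, ∀ v ∈ W i, #{u ∈ W i | G.Adj v u} ≤ K) :
    (#{v | (#{u | G.Adj v u} : ℝ) < (1 - 1 / ((s : ℝ) + 1) - α) * Fintype.card V} : ℝ) ≤
      α * Fintype.card V := by
  set N : ℝ := (Fintype.card V : ℝ) with hNdef
  have hs : (0 : ℝ) < s + 1 := by positivity
  have hk' : (1 : ℝ) ≤ k := by exact_mod_cast hk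
  have hN : 0 < N := by
    have : 0 < μ * N := lt_of_lt_of_le (by positivity) hK
    exact pos_of_mul_pos_right this hμ.le
  have hWlow : ∀ i, N / (s + 1) - (5 * 4 ^ k + 6) * μ * N ≤ #(W i) := by
    intro i
    have h1 : ∑ j ∈ univ.erase i, (#(W j) : ℝ) ≤ s * ((1 + 6 * μ) * N / (s + 1)) := by
      refine (sum_le_sum fun j _ => hW j).trans (le_of_eq ?_)
      rw [sum_const, card_erase_of_mem (mem_univ i)]
      simp
    have h2 := add_sum_erase univ (fun j => (#(W j) : ℝ)) (mem_univ i)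
    have h3 : (s : ℝ) * ((1 + 6 * μ) * N / (s + 1)) =
        (1 + 6 * μ) * N - (1 + 6 * μ) * (N / (s + 1)) := by
      field_simp
      ring
    have h4 : 0 ≤ μ * (N / (s + 1)) := by positivity
    linarith
  have hWhalf : ∀ i, N / (2 * (s + 1)) ≤ #(W i) := by
    intro i
    refine le_trans ?_ (hWlow i)
    have h1 : (5 * 4 ^ k + 6) * μ ≤ 1 / (2 * (s + 1)) := by
      rw [le_div_iff₀ (by positivity)]
      linarith
    have h2 : (5 * 4 ^ k + 6) * μ * N ≤ 1 / (2 * (s + 1)) * N := by gcongr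
    have h3 : N / (s + 1) = N / (2 * (s + 1)) + 1 / (2 * (s + 1)) * N := by
      field_simp
      ring
    linarith
  have hWpos : ∀ i, (0 : ℝ) < #(W i) := fun i => lt_of_lt_of_le (by positivity) (hWhalf i)
  set bad : Fin (s + 1) → Finset V :=
    fun i => {v ∈ W i | α / 2 * N < nonNbrCount G v (W i)ᶜ} with hbaddef
  have hbad : ∀ i, (#(bad i) : ℝ) ≤ α / 2 * #(W i) := by
    intro i
    have h := card_many_outside_nonNbr_le (η := (5 * 4 ^ k + 9) * μ) (β := α ^ 2 / 8)
      (γ := α / 2) G hk hB (W i) (by exact_mod_cast hWpos i) (by positivity)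
      (fun v hv => by convert hKW i v hv) ?_ hμβ
    · refine le_of_mul_le_mul_left (h.trans (le_of_eq ?_)) (by positivity : 0 < α / 2)
      ring
    · have h1 : (k : ℝ) ^ 2 * (K + 1) * N / #(W i) ≤ μ * N := by
        rw [div_le_iff₀ (hWpos i)]
        calc (k : ℝ) ^ 2 * (K + 1) * N
            = 2 * (s + 1) * k ^ 2 * (K + 1) * (N / (2 * (s + 1))) := by field_simp
          _ ≤ μ * N * #(W i) := by
            gcongr
            exact hWhalf i
      have h2 : (k : ℝ) * (K + 1) ≤ μ * N := by
        refine le_trans ?_ hK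
        have h3 : (k : ℝ) ≤ k ^ 2 := le_self_pow₀ hk' (by norm_num)
        have h4 : (1 : ℝ) ≤ 2 * (s + 1) := by
          have : (0 : ℝ) ≤ s := by positivity
          linarith
        have h5 : (k : ℝ) ≤ 2 * (s + 1) * k ^ 2 :=
          h3.trans (le_mul_of_one_le_left (by positivity) h4)
        gcongr
      have h3 : (1 + μ) * N / (s + 1) ≤ N / (s + 1) + μ * N := by
        have : μ * N / (s + 1) ≤ μ * N := div_le_self (by positivity) (by
          have : (0 : ℝ) ≤ s := by positivity
          linarith)
        have h4 : (1 + μ) * N / (s + 1) = N / (s + 1) + μ * N / (s + 1) := by ring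
        linarith
      have h4 := hWlow i
      linarith
  have hunion : (#(univ.biUnion W) : ℝ) = ∑ i, (#(W i) : ℝ) := by
    rw [card_biUnion fun i _ j _ hij => hdisj i j hij]
    push_cast
    rfl
  have hsub : ({v | (#{u | G.Adj v u} : ℝ) < (1 - 1 / ((s : ℝ) + 1) - α) * N} : Finset V) ⊆
      (univ.biUnion W)ᶜ ∪ univ.biUnion bad := by
    intro v hv
    by_contra hcon
    simp only [mem_union, mem_compl, mem_biUnion, mem_univ, true_and, not_or] at hcon
    obtain ⟨i, hi⟩ := not_not.1 hcon.1
    have h1 := not_exists.1 hcon.2 i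
    simp only [hbaddef, mem_filter, hi, true_and, not_lt] at h1
    have h2 := (mem_filter.1 hv).2
    have h3 : (#{u | G.Adj v u} : ℝ) + nonNbrCount G v univ = N := by
      rw [hNdef, ← card_univ]
      exact_mod_cast card_nbr_add_nonNbrCount G v univ
    have h4 : nonNbrCount G v univ ≤ #(W i) + nonNbrCount G v (W i)ᶜ := by
      refine le_trans ?_ (Nat.add_le_add_right (nonNbrCount_le G v (W i)) _)
      simp only [nonNbrCount]
      rw [← union_compl (W i), filter_union]
      simpa using card_union_le _ _
    have h4' : (nonNbrCount G v univ : ℝ) ≤ #(W i) + nonNbrCount G v (W i)ᶜ := by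
      exact_mod_cast h4
    have h5 : (1 + 6 * μ) * N / (s + 1) ≤ N / (s + 1) + α / 2 * N := by
      have h6 : 6 * μ * N / (s + 1) ≤ 6 * μ * N := div_le_self (by positivity) (by
          have : (0 : ℝ) ≤ s := by positivity
          linarith)
      have h7 : 6 * μ * N ≤ α / 2 * N := by gcongr
      have h8 : (1 + 6 * μ) * N / (s + 1) = N / (s + 1) + 6 * μ * N / (s + 1) := by ring
      linarith
    have h6 := hW i
    have h7 : (1 - 1 / ((s : ℝ) + 1) - α) * N = N - N / (s + 1) - α * N := by ring
    linarith
  have hcard : (#({v | (#{u | G.Adj v u} : ℝ) < (1 - 1 / ((s : ℝ) + 1) - α) * N} : Finset V) : ℝ)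
      ≤ #(univ.biUnion W)ᶜ + ∑ i, #(bad i) := by
    exact_mod_cast (card_le_card hsub).trans ((card_union_le _ _).trans
      (Nat.add_le_add_left card_biUnion_le _))
  refine hcard.trans ?_
  have h1 : (#(univ.biUnion W)ᶜ : ℝ) = N - ∑ i, (#(W i) : ℝ) := by
    rw [← hunion, card_compl, Nat.cast_sub (card_le_univ _)]
  have h2 : ∑ i, (#(bad i) : ℝ) ≤ α / 2 * N := by
    calc ∑ i, (#(bad i) : ℝ) ≤ ∑ i, α / 2 * (#(W i) : ℝ) := sum_le_sum fun i _ => hbad i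
      _ = α / 2 * #(univ.biUnion W) := by rw [← mul_sum, hunion]
      _ ≤ α / 2 * N := by
        gcongr
        rw [hNdef]
        exact_mod_cast card_le_univ (univ.biUnion W)
  have h3 : 5 * 4 ^ k * μ * N ≤ α / 2 * N := by gcongr
  push_cast
  linarith

/-- The degree statement under explicit numerical hypotheses. -/
lemma exists_card_low_degree_le (k a s : ℕ) (hk : 1 ≤ k) (ha : 1 ≤ a) (α : ℝ) (hα : 0 < α) :
    ∃ μ : ℝ, 0 < μ ∧ ∃ κ : ℝ, 0 < κ ∧ ∃ C T : ℕ, 1 ≤ C ∧ ∀ (N n b : ℕ) (G : SimpleGraph (Fin N)),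
      (2 : ℝ) ^ (C * (b + T)) ≤ κ * N → (n : ℝ) ≤ (1 + μ) * N / (s + 1) →
      ¬ HasCopy G (KMulti (fun i : Fin (s + 2) =>
        if (i : ℕ) = 0 then 1 else if (i : ℕ) = 1 then a else b)) →
      ¬ HasCopy Gᶜ (Book k n) →
      (#{v | (#{u | G.Adj v u} : ℝ) < (1 - 1 / ((s : ℝ) + 1) - α) * N} : ℝ) ≤ α * N := by
  set L : ℝ := 5 * 4 ^ k + 9
  have h4k : (0 : ℝ) < 4 ^ k := by positivity
  have hL : 0 < L := by positivity
  have hs : (0 : ℝ) ≤ s := by positivity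
  have ha' : (1 : ℝ) ≤ a := by exact_mod_cast ha
  have hk' : (1 : ℝ) ≤ k := by exact_mod_cast hk
  obtain ⟨μ, hμ, h1, h2, h3⟩ : ∃ μ : ℝ, 0 < μ ∧ L * μ ≤ α / 2 ∧ L * μ ≤ 1 / (2 * (s + 1)) ∧
      L * μ ≤ (α ^ 2 / 8) ^ (k + 1) := by
    refine ⟨min (α / 2) (min (1 / (2 * (s + 1))) ((α ^ 2 / 8) ^ (k + 1))) / L, by positivity, ?_⟩
    rw [mul_div_cancel₀ _ hL.ne']
    exact ⟨min_le_left _ _, (min_le_right _ _).trans (min_le_left _ _),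
      (min_le_right _ _).trans (min_le_right _ _)⟩
  have hLμ : L * μ = 5 * 4 ^ k * μ + 9 * μ := by ring
  have h4kμ : 0 < 5 * 4 ^ k * μ := by positivity
  rw [le_div_iff₀ (by positivity)] at h2
  have h2' : 2 * (s + 1) * (5 * 4 ^ k + 6) * μ ≤ 1 := by
    have : 0 ≤ 2 * (s + 1) * (3 * μ) := by positivity
    linarith
  have hμs : 4 * μ * (s + 1) < 1 := by
    have : 0 < (5 * 4 ^ k * μ + 7 * μ) * (s + 1) := by positivity
    linarith
  have hμ1 : μ ≤ 1 / 2 := by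
    have : 0 ≤ μ * s := by positivity
    linarith
  set D : ℕ := ⌈(k : ℝ) / μ⌉₊ + 2
  set T : ℕ := a + ⌈(k : ℝ) ^ 2 * (s + 1) / μ⌉₊
  set C : ℕ := (s + 2) * D ^ (s + 2) + (s + 2) + D ^ (s + 2)
  refine ⟨μ, hμ, μ / (4 * (s + 1) * k ^ 2 * a), by positivity, C, T, by omega, ?_⟩
  intro N n b G hN hn hfree hB
  have hDμ : (k : ℝ) ≤ μ * D := by
    rw [← div_le_iff₀' hμ]
    exact (Nat.le_ceil _).trans (by simp [D])
  have htμ : (k : ℝ) ^ 2 * (s + 1) ≤ μ * (b + T : ℕ) := by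
    rw [← div_le_iff₀' hμ]
    refine (Nat.le_ceil _).trans ?_
    exact_mod_cast (by omega : ⌈(k : ℝ) ^ 2 * (s + 1) / μ⌉₊ ≤ b + T)
  rw [div_mul_eq_mul_div, le_div_iff₀ (by positivity)] at hN
  have hpow : (1 : ℝ) ≤ 2 ^ (C * (b + T)) := one_le_pow₀ (by norm_num)
  have hk2 : (1 : ℝ) ≤ k ^ 2 := one_le_pow₀ hk'
  have hka : (1 : ℝ) ≤ 4 * (s + 1) * k ^ 2 * a := by
    have h5 : (1 : ℝ) ≤ 4 * (s + 1) := by linarith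
    exact one_le_mul_of_one_le_of_one_le (one_le_mul_of_one_le_of_one_le h5 hk2) ha'
  have hN' : (2 : ℝ) ^ (C * (b + T)) ≤ μ * N :=
    (le_mul_of_one_le_right (by positivity) hka).trans hN
  obtain ⟨W, hW1, hW2, hW3, hW4⟩ := exists_sparse_classes (t := b + T) (D := D) (μ := μ) G hk ha
    (by omega) (by omega) (by omega) hμ hμ1 hμs (by omega) hDμ htμ
    (by simpa using hN') (by simpa using hn) hfree hB
  have := card_low_degree_le (K := 2 ^ (C * (b + T)) * a) (μ := μ) G hk hα hμ
    (by linarith) (by linarith) h2' h3 (by simpa using hn) ?_ hB W hW1 hW2 hW3 ?_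
  · simpa using this
  · have h6 : (1 : ℝ) ≤ 2 ^ (C * (b + T)) * a := one_le_mul_of_one_le_of_one_le hpow ha'
    rw [Fintype.card_fin]
    refine le_trans ?_ hN
    push_cast
    calc 2 * (s + 1) * (k : ℝ) ^ 2 * (2 ^ (C * (b + T)) * a + 1)
        ≤ 2 * (s + 1) * (k : ℝ) ^ 2 * (2 ^ (C * (b + T)) * a + 2 ^ (C * (b + T)) * a) := by gcongr
      _ = _ := by ring
  · exact fun i v hv => by convert hW4 i v hv

/-- Exponentials of small multiples of `log n` are eventually below any multiple of `n`. -/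
lemma exists_pow_le_mul (C T : ℕ) (hC : 1 ≤ C) {κ : ℝ} (hκ : 0 < κ) :
    ∃ δ : ℝ, 0 < δ ∧ ∃ n₀ : ℕ, ∀ n : ℕ, n₀ ≤ n → ∀ b : ℕ, (b : ℝ) ≤ δ * Real.log n →
      (2 : ℝ) ^ (C * (b + T)) ≤ κ * n := by
  have hC' : (0 : ℝ) < C := by exact_mod_cast hC
  refine ⟨1 / (2 * C), by positivity, ⌈((2 : ℝ) ^ (C * T) / κ) ^ 2⌉₊ + 1, fun n hn b hb => ?_⟩
  have hn0 : (0 : ℝ) < n := by exact_mod_cast (by omega : 0 < n)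
  have hn1 : ((2 : ℝ) ^ (C * T) / κ) ^ 2 ≤ n :=
    (Nat.le_ceil _).trans (by exact_mod_cast (by omega : ⌈((2 : ℝ) ^ (C * T) / κ) ^ 2⌉₊ ≤ n))
  have hsqrt : (2 : ℝ) ^ (C * T) ≤ κ * √n := by
    rw [← div_le_iff₀' hκ]
    exact Real.le_sqrt_of_sq_le hn1
  have hb' : (C * b : ℝ) ≤ Real.log n / 2 := by
    calc (C * b : ℝ) ≤ C * (1 / (2 * C) * Real.log n) := by gcongr
      _ = _ := by field_simp
  have hexp : (2 : ℝ) ^ (C * b) ≤ √n := by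
    calc (2 : ℝ) ^ (C * b) ≤ Real.exp 1 ^ (C * b) := by
          gcongr
          linarith [Real.add_one_le_exp 1]
      _ = Real.exp (C * b) := by rw [← Real.exp_nat_mul]; simp
      _ ≤ Real.exp (Real.log n / 2) := Real.exp_le_exp.2 hb'
      _ = √n := by rw [← Real.log_sqrt hn0.le, Real.exp_log (Real.sqrt_pos.2 hn0)]
  calc (2 : ℝ) ^ (C * (b + T)) = 2 ^ (C * b) * 2 ^ (C * T) := by rw [mul_add, pow_add]
    _ ≤ √n * (κ * √n) := by gcongr
    _ = κ * (√n * √n) := by ring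
    _ = κ * n := by rw [Real.mul_self_sqrt hn0.le]

end Preliminaries

/-- Lemma 5.4: for `k, a ≥ 1`, `p ≥ 2` and `α > 0`, for all sufficiently small `μ > 0`
there are `δ > 0` and `n₀` such that for all `n ≥ n₀` and `1 ≤ b ≤ δ ln n`: if `G` is a
`K_p(1,a,b,…,b)`-free graph on `N ≥ (p-1-μ)n` vertices whose complement is `B_{k,n}`-free,
then all but at most `αN` vertices of `G` have degree at least `(1 - 1/(p-1) - α)N`. -/
theorem degree_lemma_log (k a p : ℕ) (hk : 1 ≤ k) (ha : 1 ≤ a) (hp : 2 ≤ p)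
    (α : ℝ) (hα : 0 < α) :
    ∃ μ₀ : ℝ, 0 < μ₀ ∧ ∀ μ : ℝ, 0 < μ → μ ≤ μ₀ →
      ∃ δ : ℝ, 0 < δ ∧ ∃ n₀ : ℕ, ∀ n : ℕ, n₀ ≤ n →
        ∀ b : ℕ, 1 ≤ b → (b : ℝ) ≤ δ * Real.log n →
        ∀ N : ℕ, ((p : ℝ) - 1 - μ) * n ≤ (N : ℝ) →
        ∀ G : SimpleGraph (Fin N),
          ¬ HasCopy G (KMulti (fun i : Fin p =>
              if (i : ℕ) = 0 then 1 else if (i : ℕ) = 1 then a else b)) →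
          ¬ HasCopy Gᶜ (Book k n) →
          (({v : Fin N |
              ((G.neighborSet v).ncard : ℝ) < (1 - 1 / ((p : ℝ) - 1) - α) * N}.ncard : ℝ)
            ≤ α * N) := by
  classical
  obtain ⟨s, rfl⟩ : ∃ s, p = s + 2 := ⟨p - 2, by omega⟩
  obtain ⟨ν, hν, κ, hκ, C, T, hC, hcore⟩ := exists_card_low_degree_le k a s hk ha α hα
  have hs : (0 : ℝ) ≤ s := by positivity
  refine ⟨min (1 / 2) (ν / (1 + ν)), by positivity, fun μ hμ hμ₀ => ?_⟩
  obtain ⟨δ, hδ, n₀, hpow⟩ := exists_pow_le_mul C T hC (half_pos hκ)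
  refine ⟨δ, hδ, n₀, fun n hn b _ hbn N hN G hfree hB => ?_⟩
  have hμ1 : μ ≤ 1 / 2 := hμ₀.trans (min_le_left _ _)
  have hμ2 : μ * (1 + ν) ≤ ν := by
    rw [← le_div_iff₀ (by positivity)]
    exact hμ₀.trans (min_le_right _ _)
  have hps : ((s + 2 : ℕ) : ℝ) - 1 = s + 1 := by push_cast; ring
  rw [hps] at hN ⊢
  have hn0 : (0 : ℝ) ≤ n := by positivity
  have hnN : (n : ℝ) ≤ 2 * N := by
    have : 0 ≤ (s + (1 / 2 - μ)) * (n : ℝ) := mul_nonneg (by linarith) hn0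
    linarith
  have hsize : (2 : ℝ) ^ (C * (b + T)) ≤ κ * N := by
    refine (hpow n hn b hbn).trans ?_
    calc κ / 2 * n ≤ κ / 2 * (2 * N) := by gcongr
      _ = κ * N := by ring
  have hnle : (n : ℝ) ≤ (1 + ν) * N / (s + 1) := by
    rw [le_div_iff₀ (by positivity)]
    have h1 : (s + 1 : ℝ) ≤ (1 + ν) * (s + 1 - μ) := by
      have := mul_nonneg hν.le hs
      linarith
    calc (n : ℝ) * (s + 1) ≤ n * ((1 + ν) * (s + 1 - μ)) := by gcongr
      _ = (1 + ν) * ((s + 1 - μ) * n) := by ring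
      _ ≤ _ := by gcongr
  have h := hcore N n b G hsize hnle hfree hB
  have hdeg : ∀ v, (G.neighborSet v).ncard = (Finset.univ.filter fun u => G.Adj v u).card := by
    intro v
    rw [← Set.ncard_coe_finset]
    congr 1
    ext u
    simp
  rw [← Set.ncard_coe_finset] at h
  convert h using 3
  ext v
  rw [Set.mem_ofPred_eq, hdeg, Finset.mem_coe, Finset.mem_filter]
  simp only [Finset.mem_univ, true_and]
end

section
/- Let p ≥ 2 and a ≥ 1 be integers. There exists α₀ > 0 (depending only on p and a) such that for every 0 < α ≤ α₀ there exists N₀ with the following property for all N ≥ N₀. Let G be a graph on N vertices and T ⊆ V(G) a set such that every vertex of T has degree greater than (1 − 1/(p−1) − α)N in G, |T| ≥ (1 − α)N, and the induced subgraph G[T] has minimum degree at least (1 − 1/(p−1) − 2α)|T|. Suppose T is partitioned as T = T₁ ⊔ ⋯ ⊔ T_{p−1} so that each vertex of T_i has at most a − 1 neighbors in T_i, for every i. Then, setting ξ = 2p²α, for all distinct i, j ∈ {1,…,p−1}: (i) ||T_i| − N/(p−1)| ≤ ξN, and (ii) every vertex v ∈ T_i has at least (1 − ξ)|T_j| neighbors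 in T_j. -/
open SimpleGraph

theorem ncard_add_ncard_neighborSet_le {N : ℕ} (G : SimpleGraph (Fin N)) (v : Fin N)
    (A : Set (Fin N)) : A.ncard + (G.neighborSet v).ncard ≤ N + degIn G v A := by
  have h := Set.ncard_union_add_ncard_inter A (G.neighborSet v)
  have hu : (A ∪ G.neighborSet v).ncard ≤ N := by
    simpa using Set.ncard_le_card (A ∪ G.neighborSet v)
  have hi : (A ∩ G.neighborSet v).ncard = degIn G v A := rfl
  omega

theorem degIn_union_le {V : Type*} (G : SimpleGraph V) (v : V) (A B : Set V) :
    degIn G v (A ∪ B) ≤ degIn G v A + degIn G v B := by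
  have h : {u ∈ A ∪ B | G.Adj v u} = {u ∈ A | G.Adj v u} ∪ {u ∈ B | G.Adj v u} :=
    Set.union_inter_distrib_right A B {u | G.Adj v u}
  unfold degIn
  rw [h]
  exact Set.ncard_union_le _ _

theorem ncard_iUnion_eq_sum {ι V : Type*} [Fintype ι] [Finite V] (P : ι → Set V)
    (hP : Pairwise fun i j => Disjoint (P i) (P j)) :
    (⋃ i, P i).ncard = ∑ i, (P i).ncard := by
  rw [Set.ncard_iUnion_of_finite (fun i => Set.toFinite _) hP, finsum_eq_sum_of_fintype]

/-- Claim 4.1: for `p ≥ 2`, `a ≥ 1` there is `α₀ > 0` such that for every `0 < α ≤ α₀`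
there is `N₀` with the following property for all `N ≥ N₀`.  If every vertex of `T` has
degree greater than `(1 - 1/(p-1) - α)N`, `|T| ≥ (1-α)N`, `G[T]` has minimum degree at
least `(1 - 1/(p-1) - 2α)|T|`, and `T = T₁ ⊔ ⋯ ⊔ T_{p-1}` with each vertex of `T_i` having
at most `a - 1` neighbors in `T_i`, then with `ξ = 2p²α`:
(i) `||T_i| - N/(p-1)| ≤ ξN` and (ii) every `v ∈ T_i` has at least `(1-ξ)|T_j|` neighbors
in `T_j` for `j ≠ i`. -/
theorem parts_structure (p a : ℕ) (hp : 2 ≤ p) (ha : 1 ≤ a) :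
    ∃ α₀ : ℝ, 0 < α₀ ∧ ∀ α : ℝ, 0 < α → α ≤ α₀ → ∃ N₀ : ℕ, ∀ N : ℕ, N₀ ≤ N →
      ∀ G : SimpleGraph (Fin N), ∀ T : Set (Fin N),
        (∀ v ∈ T, (1 - 1 / ((p : ℝ) - 1) - α) * N < ((G.neighborSet v).ncard : ℝ)) →
        ((1 - α) * N ≤ (T.ncard : ℝ)) →
        (∀ v ∈ T, (1 - 1 / ((p : ℝ) - 1) - 2 * α) * T.ncard ≤ (degIn G v T : ℝ)) →
        ∀ P : Fin (p - 1) → Set (Fin N),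
          (Pairwise fun i j => Disjoint (P i) (P j)) → (⋃ i, P i) = T →
          (∀ i, ∀ v ∈ P i, degIn G v (P i) ≤ a - 1) →
          (∀ i, |((P i).ncard : ℝ) - (N : ℝ) / ((p : ℝ) - 1)| ≤ 2 * (p : ℝ) ^ 2 * α * N) ∧
          (∀ i j, i ≠ j → ∀ v ∈ P i,
            (1 - 2 * (p : ℝ) ^ 2 * α) * (P j).ncard ≤ (degIn G v (P j) : ℝ)) := by
  obtain ⟨m, rfl⟩ : ∃ m, p = m + 1 := ⟨p - 1, by omega⟩
  have hm : (1 : ℝ) ≤ m := by exact_mod_cast (by omega : 1 ≤ m)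
  have hm0 : (0 : ℝ) < m := by linarith
  simp only [Nat.cast_add, Nat.cast_one, add_sub_cancel_right]
  refine ⟨1 / (2 * ((m : ℝ) + 1) ^ 3), by positivity, fun α hα hα₀ => ?_⟩
  obtain ⟨N₀, hN₀⟩ := exists_nat_ge ((a : ℝ) / α)
  refine ⟨N₀, fun N hN G T hdeg hT _ P hdisj hunion hP => ?_⟩
  have haN : (a : ℝ) ≤ α * N := by
    have h : (a : ℝ) / α ≤ N := hN₀.trans (by exact_mod_cast hN)
    rw [div_le_iff₀ hα] at h
    linarith
  have hN0 : (0 : ℝ) ≤ N := N.cast_nonneg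
  have hαN : 0 ≤ α * N := by positivity
  have hdeg' : ∀ i, ∀ v ∈ P i,
      (1 - 1 / (m : ℝ) - α) * N < ((G.neighborSet v).ncard : ℝ) := fun i v hv =>
    hdeg v (hunion ▸ Set.mem_iUnion_of_mem i hv)
  have hown : ∀ i, ∀ v ∈ P i, (degIn G v (P i) : ℝ) ≤ α * N := fun i v hv =>
    le_trans (by exact_mod_cast (hP i v hv).trans (Nat.sub_le a 1)) haN
  have hupper : ∀ i, ((P i).ncard : ℝ) ≤ (1 / m + 2 * α) * N := by
    intro i
    rcases (P i).eq_empty_or_nonempty with h | ⟨v, hv⟩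
    · rw [h, Set.ncard_empty, Nat.cast_zero]
      positivity
    · have h : ((P i).ncard : ℝ) + (G.neighborSet v).ncard ≤ N + degIn G v (P i) := by
        exact_mod_cast ncard_add_ncard_neighborSet_le G v (P i)
      linarith [hdeg' i v hv, hown i v hv]
  have hlower : ∀ i, (1 / m - (2 * m - 1) * α) * N ≤ ((P i).ncard : ℝ) := by
    intro i
    have hsum : (T.ncard : ℝ) = ∑ j, ((P j).ncard : ℝ) := by
      rw [← hunion]
      exact_mod_cast ncard_iUnion_eq_sum P hdisj
    rw [← Finset.add_sum_erase _ _ (Finset.mem_univ i)] at hsum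
    have hrest : ∑ j ∈ Finset.univ.erase i, ((P j).ncard : ℝ) ≤
        ((m : ℝ) - 1) * ((1 / m + 2 * α) * N) := by
      refine (Finset.sum_le_card_nsmul _ _ _ fun j _ => hupper j).trans_eq ?_
      rw [Finset.card_erase_of_mem (Finset.mem_univ i), Finset.card_univ, Fintype.card_fin, Nat.add_sub_cancel,
        nsmul_eq_mul, Nat.cast_sub (by exact_mod_cast hm), Nat.cast_one]
    have hid : (1 - α) * N - ((m : ℝ) - 1) * ((1 / m + 2 * α) * N) =
        (1 / m - (2 * m - 1) * α) * N := by
      field_simp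
      ring
    linarith
  refine ⟨fun i => ?_, fun i j hij v hv => ?_⟩
  · have hu := hupper i
    have hl := hlower i
    have hdiv : (N : ℝ) / m = 1 / m * N := by ring
    rw [abs_le, hdiv]
    constructor <;> nlinarith [mul_nonneg hαN hm0.le, mul_nonneg hαN (sq_nonneg (m : ℝ))]
  · have hmiss : ((P j).ncard : ℝ) - degIn G v (P j) ≤ (2 * m + 1) * α * N := by
      have h := ncard_add_ncard_neighborSet_le G v (P i ∪ P j)
      rw [Set.ncard_union_eq (hdisj hij)] at h
      have h' : ((P i).ncard : ℝ) + (P j).ncard + (G.neighborSet v).ncard ≤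
          N + (degIn G v (P i) + degIn G v (P j)) := by
        exact_mod_cast h.trans (Nat.add_le_add_left (degIn_union_le G v _ _) N)
      linarith [hdeg' i v hv, hown i v hv, hlower i]
    have hsmall : 2 * ((m : ℝ) + 1) ^ 3 * α ≤ 1 := by
      rw [le_div_iff₀ (by positivity)] at hα₀
      linarith
    have hcoef : 2 * (m : ℝ) + 1 ≤ 2 * (m + 1) ^ 2 * (1 / m - (2 * m - 1) * α) := by
      have hinv : 2 * ((m : ℝ) + 1) ^ 2 * (1 / m) = 2 * m + 4 + 2 * (1 / m) := by
        field_simp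
        ring
      have hinv0 : 0 < 1 / (m : ℝ) := by positivity
      have herr : 2 * ((m : ℝ) + 1) ^ 2 * ((2 * m - 1) * α) ≤ 2 := by
        have : 0 ≤ 2 * ((m : ℝ) + 1) ^ 2 * α := by positivity
        nlinarith
      linarith
    have hbound : (2 * m + 1) * α * N ≤ 2 * ((m : ℝ) + 1) ^ 2 * α * (P j).ncard := by
      calc (2 * m + 1) * α * N = (2 * m + 1) * (α * N) := by ring
        _ ≤ 2 * (m + 1) ^ 2 * (1 / m - (2 * m - 1) * α) * (α * N) := by gcongr
        _ = 2 * ((m : ℝ) + 1) ^ 2 * α * ((1 / m - (2 * m - 1) * α) * N) := by ring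
        _ ≤ 2 * ((m : ℝ) + 1) ^ 2 * α * (P j).ncard := by gcongr; exact hlower j
    linarith
end
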